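/- arXiv:1510.01349 — 2 statements merged into one kernel-verified Lean document; each statement's English description precedes it below -/
import Mathlib

section
/- Let n ≥ 2 and let m, ℓ be positive integers. Let P_1, …, P_n be polynomials with rational coefficients that map ℤ into ℤ and have positive leading coefficient (so P_i(t) > 0 for all sufficiently large t). Then the function D, defined for all sufficiently large positive integers t by D(t) = F_{m,ℓ}(P_1(t), …, P_n(t)), is eventually quasi-polynomial. -/
/-- `repCount a k` is the number of tuples `b` of nonnegative integers with
`k = ∑ i, b i * a i`. -/
noncomputable def repCount {n : ℕ} (a : Fin n → ℤ) (k : ℤ) : ℕ :=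
  Set.ncard {b : Fin n → ℕ | k = ∑ i, (b i : ℤ) * a i}

/-- The set of multiples of `gcd(a₁, …, aₙ)` with fewer than `m` representations. -/
def frobSet {n : ℕ} (a : Fin n → ℤ) (m : ℕ) : Set ℤ :=
  {k : ℤ | Finset.univ.gcd a ∣ k ∧ repCount a k < m}

/-- A function `f` (on sufficiently large positive integers) is eventually
quasi-polynomial if there are a period `d > 0` and rational polynomials `R₀, …, R_{d-1}`
with `f t = R_{t mod d}(t)` for all sufficiently large `t`. -/
def IsEQP (f : ℕ → ℤ) : Prop :=
  ∃ d : ℕ, 0 < d ∧ ∃ R : ℕ → Polynomial ℚ, ∃ N : ℕ,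
    ∀ t : ℕ, N ≤ t → (f t : ℚ) = (R (t % d)).eval (t : ℚ)



namespace FML

/-- Expressions of the form `∑ⱼ Lⱼ(z) (z τ)^j` with `Lⱼ` affine forms. -/
inductive PL {V : Type} (τ : V) : ((V → ℕ) → ℤ) → Prop
  | const (e : ℤ) : PL τ (fun _ => e)
  | step (c : ℤ) (f : (V → ℕ) →+ ℤ) (E : (V → ℕ) → ℤ) (h : PL τ E) :
      PL τ (fun z => c + f z + (z τ : ℤ) * E z)

lemma PL.add_const {V : Type} {τ : V} {E : (V → ℕ) → ℤ} (h : PL τ E) (e : ℤ) :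
    PL τ (fun z => E z + e) := by
  cases h with
  | const e' => exact PL.const (e' + e)
  | step c f E h =>
    have := PL.step (c + e) f E h
    convert this using 2
    ring

lemma PL.add {V : Type} {τ : V} {E : (V → ℕ) → ℤ} (h : PL τ E) :
    ∀ {E' : (V → ℕ) → ℤ}, PL τ E' → PL τ (fun z => E z + E' z) := by
  induction h with
  | const e =>
    intro E' h'
    have := h'.add_const e
    convert this using 2
    ring
  | step c f E h ih =>
    intro E' h'
    cases h' with
    | const e => exact (PL.step c f E h).add_const e
    | step c' f' E' h' =>
      have := PL.step (c + c') (f + f') _ (ih h')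
      convert this using 2
      simp only [AddMonoidHom.add_apply]
      ring

lemma PL.smul {V : Type} {τ : V} {E : (V → ℕ) → ℤ} (h : PL τ E) (a : ℤ) :
    PL τ (fun z => a * E z) := by
  induction h with
  | const e => exact PL.const (a * e)
  | step c f E h ih =>
    have := PL.step (a * c) (a • f) _ ih
    convert this using 2
    simp only [AddMonoidHom.smul_apply, smul_eq_mul]
    ring

lemma PL.tmul {V : Type} {τ : V} {E : (V → ℕ) → ℤ} (h : PL τ E) :
    PL τ (fun z => (z τ : ℤ) * E z) := by
  have := PL.step 0 0 _ h
  convert this using 2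
  simp

lemma PL.tpow {V : Type} {τ : V} {E : (V → ℕ) → ℤ} (h : PL τ E) (k : ℕ) :
    PL τ (fun z => (z τ : ℤ) ^ k * E z) := by
  induction k with
  | zero => simpa using h
  | succ k ih =>
    have := ih.tmul
    convert this using 2
    ring

lemma PL.sum {V : Type} {τ : V} {α : Type} (s : Finset α) (E : α → (V → ℕ) → ℤ)
    (h : ∀ i ∈ s, PL τ (E i)) : PL τ (fun z => ∑ i ∈ s, E i z) := by
  classical
  induction s using Finset.induction_on with
  | empty => simpa using PL.const 0
  | insert a s ha ih =>
    simp only [Finset.sum_insert ha]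
    exact (h a (by simp)).add (ih fun i hi => h i (by simp [hi]))

lemma PL.polyMul {V : Type} {τ : V} {E : (V → ℕ) → ℤ} (h : PL τ E) (Q : Polynomial ℤ) :
    PL τ (fun z => Q.eval (z τ : ℤ) * E z) := by
  have := PL.sum (Finset.range (Q.natDegree + 1)) _ (fun i _ => (h.tpow i).smul (Q.coeff i))
  convert this using 2 with z
  rw [Polynomial.eval_eq_sum_range, Finset.sum_mul]
  refine Finset.sum_congr rfl fun i _ => by ring

lemma PL.coord {V : Type} {τ : V} (v : V) : PL τ (fun z => (z v : ℤ)) := by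
  have := PL.step (τ := τ) 0 ((Nat.castAddMonoidHom ℤ).comp (Pi.evalAddMonoidHom (fun _ : V => ℕ) v))
    _ (PL.const 0)
  convert this using 2
  simp

lemma hom_bound {V : Type} [Fintype V] (f : (V → ℕ) →+ ℤ) :
    ∃ B : ℕ, ∀ (z : V → ℕ) (t : ℕ), (∀ v, z v ≤ t) → |f z| ≤ B * t := by
  classical
  refine ⟨∑ v, (f (Pi.single v 1)).natAbs, fun z t hz => ?_⟩
  have h1 : f z = ∑ v, (z v : ℤ) * f (Pi.single v 1) := by
    conv_lhs => rw [← Finset.univ_sum_single z]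
    rw [map_sum]
    refine Finset.sum_congr rfl fun v _ => ?_
    have : (Pi.single v (z v) : V → ℕ) = z v • Pi.single v 1 := by
      rw [← Pi.single_smul]; simp
    rw [this, map_nsmul]; simp
  rw [h1]
  refine (Finset.abs_sum_le_sum_abs _ _).trans ?_
  push_cast
  rw [Finset.sum_mul]
  refine Finset.sum_le_sum fun v _ => ?_
  rw [abs_mul, mul_comm]
  have : |(z v : ℤ)| ≤ t := by rw [abs_of_nonneg (by positivity)]; exact_mod_cast hz v
  gcongr

lemma semi_lt {V : Type} [Finite V] (a b : V) : IsSemilinearSet {z : V → ℕ | z a < z b} := by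
  have h : IsSemilinearSet {x : V ⊕ Unit → ℕ |
      (fun (z : V → ℕ) (y : Unit → ℕ) => 1 + (z a + y ()) = z b) (x ∘ Sum.inl) (x ∘ Sum.inr)} := by
    have := isSemilinearSet_setOfPred_eq (M := V ⊕ Unit → ℕ) (N := ℕ) 1 0
      (Pi.evalAddMonoidHom (fun _ : V ⊕ Unit => ℕ) (Sum.inl a) +
        Pi.evalAddMonoidHom (fun _ : V ⊕ Unit => ℕ) (Sum.inr ()))
      (Pi.evalAddMonoidHom (fun _ : V ⊕ Unit => ℕ) (Sum.inl b))
    simpa using this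
  have h2 := IsSemilinearSet.proj'
    (p := fun (z : V → ℕ) (y : Unit → ℕ) => 1 + (z a + y ()) = z b) h
  convert h2 using 1
  ext z
  simp only [Set.mem_ofPred_eq]
  constructor
  · intro h
    exact ⟨fun _ => z b - z a - 1, by dsimp only; omega⟩
  · rintro ⟨y, hy⟩
    omega

lemma semi_le {V : Type} [Finite V] (a b : V) : IsSemilinearSet {z : V → ℕ | z a ≤ z b} := by
  convert (semi_lt b a).compl using 1
  ext z
  simp

lemma semi_pos {V : Type} [Finite V] (a : V) : IsSemilinearSet {z : V → ℕ | 0 < z a} := by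
  have := (isSemilinearSet_setOfPred_eq (M := V → ℕ) (N := ℕ) 0 0
      (Pi.evalAddMonoidHom (fun _ : V => ℕ) a) (0 : (V → ℕ) →+ ℕ)).compl
  convert this using 1
  ext z
  simp [Nat.pos_iff_ne_zero]

lemma semi_forall {V α : Type} [Finite V] [Finite α] {p : α → (V → ℕ) → Prop}
    (h : ∀ i, IsSemilinearSet {z | p i z}) : IsSemilinearSet {z | ∀ i, p i z} := by
  convert IsSemilinearSet.iInter h using 1
  ext z
  simp

/-- the crucial carry argument -/
lemma PL.semilinear {V : Type} [Finite V] {τ : V} {E : (V → ℕ) → ℤ} (h : PL τ E) :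
    ∀ e : ℤ, IsSemilinearSet {z : V → ℕ | ((∀ v, z v ≤ z τ) ∧ 0 < z τ) ∧ E z + e = 0} := by
  have hbox : IsSemilinearSet {z : V → ℕ | (∀ v, z v ≤ z τ) ∧ 0 < z τ} :=
    (semi_forall fun v => semi_le v τ).inter (semi_pos τ)
  cases nonempty_fintype V
  induction h with
  | const e' =>
    intro e
    by_cases h : e' + e = 0
    · simpa [h] using hbox
    · simp [h]
  | step c f E h ih =>
    intro e
    obtain ⟨B, hB⟩ := hom_bound f
    set b : ℤ := B + |c| + |e| with hb
    have key : IsSemilinearSet (⋃ q ∈ Finset.Icc (-b) b,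
        {z : V → ℕ | (c + e) + f z = 0 + (q • (Nat.castAddMonoidHom ℤ).comp
          (Pi.evalAddMonoidHom (fun _ : V => ℕ) τ)) z} ∩
        {z : V → ℕ | ((∀ v, z v ≤ z τ) ∧ 0 < z τ) ∧ E z + q = 0}) := by
      refine IsSemilinearSet.biUnion_finset fun q _ => ?_
      exact (isSemilinearSet_setOfPred_eq (M := V → ℕ) (N := ℤ) (c + e) 0 f _).inter (ih q)
    convert key using 1
    ext z
    simp only [Set.mem_ofPred_eq, Set.mem_iUnion, Set.mem_inter_iff, Finset.mem_Icc,
      AddMonoidHom.smul_apply, AddMonoidHom.comp_apply, Pi.evalAddMonoidHom_apply,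
      Nat.coe_castAddMonoidHom, smul_eq_mul, zero_add, exists_prop]
    constructor
    · rintro ⟨⟨h1, h2⟩, h3⟩
      refine ⟨- E z, ?_, ?_, ⟨h1, h2⟩, by ring⟩
      · rw [← abs_le, abs_neg]
        have h4 : |(z τ : ℤ) * E z| ≤ b * z τ := by
          have : (z τ : ℤ) * E z = -(f z + c + e) := by linarith
          rw [this, abs_neg]
          have h5 := hB z _ h1
          have h6 := abs_add_le (f z + c) e
          have h7 := abs_add_le (f z) c
          have h8 : (1 : ℤ) ≤ z τ := by exact_mod_cast h2
          have h9 : |c| ≤ |c| * z τ := le_mul_of_one_le_right (abs_nonneg _) h8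
          have h10 : |e| ≤ |e| * z τ := le_mul_of_one_le_right (abs_nonneg _) h8
          rw [hb, add_mul, add_mul]
          linarith
        rw [abs_mul, abs_of_nonneg (by positivity : (0 : ℤ) ≤ z τ), mul_comm] at h4
        exact le_of_mul_le_mul_right h4 (by exact_mod_cast h2)
      · linarith
    · rintro ⟨q, -, h1, h2, h3⟩
      refine ⟨h2, ?_⟩
      have : E z = -q := by linarith
      rw [this]
      linarith

/-- Pumping for semilinear sets. -/
lemma pump {V : Type} (τ : V) {A : Set (V → ℕ)} (hA : IsSemilinearSet A) :
    ∃ M : ℕ, 0 < M ∧ ∃ N : ℕ, ∀ z ∈ A, N ≤ z τ → ∃ v : V → ℕ, v τ = M ∧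
      ∀ s : ℕ, z + s • v ∈ A := by
  obtain ⟨S, hS, hlin, rfl⟩ := hA
  induction S, hS using Set.Finite.induction_on with
  | empty => exact ⟨1, one_pos, 0, by simp⟩
  | @insert L S hLS hS ih =>
    obtain ⟨M, hM, N, ih⟩ := ih (fun t ht => hlin t (by simp [ht]))
    have hL : ∃ M : ℕ, 0 < M ∧ ∃ N : ℕ, ∀ z ∈ L, N ≤ z τ → ∃ v : V → ℕ, v τ = M ∧
        ∀ s : ℕ, z + s • v ∈ L := by
      obtain ⟨a, T, hT, rfl⟩ := hlin L (by simp)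
      by_cases h : ∃ p ∈ T, 0 < p τ
      · obtain ⟨p, hp, hpos⟩ := h
        refine ⟨p τ, hpos, 0, fun z hz _ => ⟨p, rfl, fun s => ?_⟩⟩
        rw [Set.mem_vadd_set] at hz ⊢
        obtain ⟨y, hy, rfl⟩ := hz
        refine ⟨y + s • p, ?_, by simp [add_assoc]⟩
        exact add_mem hy (nsmul_mem (AddSubmonoid.subset_closure hp) s)
      · push Not at h
        refine ⟨1, one_pos, a τ + 1, fun z hz hN => ?_⟩
        rw [Set.mem_vadd_set] at hz
        obtain ⟨y, hy, rfl⟩ := hz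
        have : y τ = 0 := by
          have hle : AddSubmonoid.closure T ≤
              AddMonoidHom.mker (Pi.evalAddMonoidHom (fun _ : V => ℕ) τ) := by
            rw [AddSubmonoid.closure_le]
            intro p hp
            have := h p hp
            simp only [SetLike.mem_coe, AddMonoidHom.mem_mker, Pi.evalAddMonoidHom_apply]
            omega
          simpa using hle hy
        simp [this] at hN
    obtain ⟨M', hM', N', ih'⟩ := hL
    refine ⟨M * M', by positivity, max N N', fun z hz hN => ?_⟩
    rw [Set.sUnion_insert] at hz ⊢
    rcases hz with hz | hz
    · obtain ⟨v, hv, hs⟩ := ih' z hz (le_trans (le_max_right _ _) hN)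
      refine ⟨M • v, by simp [hv], fun s => Or.inl ?_⟩
      rw [smul_smul]; exact hs _
    · obtain ⟨v, hv, hs⟩ := ih z hz (le_trans (le_max_left _ _) hN)
      refine ⟨M' • v, by simp [hv, mul_comm], fun s => Or.inr ?_⟩
      rw [smul_smul]; exact hs _

end FML
namespace FML

/-- All "digits" are smaller than the base `z none`. -/
def Cond {W : Type} (z : Option W → ℕ) : Prop := 0 < z none ∧ ∀ v, z (some v) < z none

/-- Value of a digit vector. -/
def val (K : ℕ) {ι : Type} (z : Option (ι × Fin K) → ℕ) (i : ι) : ℕ :=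
  ∑ j : Fin K, z (some (i, j)) * z none ^ (j : ℕ)

/-- Families of sets that are Presburger-definable in base-`t` digits. -/
def Good (K : ℕ) {ι : Type} (S : ℕ → Set (ι → ℕ)) : Prop :=
  IsSemilinearSet {z : Option (ι × Fin K) → ℕ | Cond z ∧ val K z ∈ S (z none)}

lemma semi_cond {W : Type} [Finite W] : IsSemilinearSet {z : Option W → ℕ | Cond z} :=
  (semi_pos none).inter (semi_forall fun v => semi_lt (some v) none)

lemma sum_digits_lt (t : ℕ) : ∀ (K : ℕ) (d : Fin K → ℕ) (_ : ∀ j, d j < t),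
    ∑ j : Fin K, d j * t ^ (j : ℕ) < t ^ K := by
  intro K
  induction K with
  | zero => intro d _; simp
  | succ K ih =>
    intro d hd
    rw [Fin.sum_univ_castSucc]
    have h1 := ih (fun j => d j.castSucc) (fun j => hd _)
    have h2 : d (Fin.last K) + 1 ≤ t := hd _
    have h3 := Nat.mul_le_mul_right (t ^ K) h2
    simp only [Fin.val_castSucc, Fin.val_last]
    rw [pow_succ']
    linarith

lemma sum_digits (t : ℕ) (y K : ℕ) :
    ∑ j : Fin K, (y / t ^ (j : ℕ) % t) * t ^ (j : ℕ) = y % t ^ K := by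
  induction K with
  | zero => simp [Nat.mod_one]
  | succ K ih =>
    rw [Fin.sum_univ_castSucc, Nat.mod_pow_succ]
    simp only [Fin.val_castSucc, Fin.val_last]
    rw [ih, mul_comm]

lemma val_lt {K : ℕ} {ι : Type} {z : Option (ι × Fin K) → ℕ} (hz : Cond z) (i : ι) :
    val K z i < z none ^ K :=
  sum_digits_lt _ K _ (fun _ => hz.2 _)

/-- digit vector of a tuple -/
def enc (K : ℕ) {ι : Type} (t : ℕ) (x : ι → ℕ) : Option (ι × Fin K) → ℕ
  | none => t
  | some (i, j) => x i / t ^ (j : ℕ) % t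

lemma enc_cond {K : ℕ} {ι : Type} {t : ℕ} (ht : 0 < t) (x : ι → ℕ) : Cond (enc K t x) :=
  ⟨ht, fun _ => Nat.mod_lt _ ht⟩

lemma val_enc {K : ℕ} {ι : Type} {t : ℕ} (x : ι → ℕ) (hx : ∀ i, x i < t ^ K) :
    val K (enc K t x) = x := by
  funext i
  simp only [val, enc]
  rw [sum_digits, Nat.mod_eq_of_lt (hx i)]

lemma Good.congr {K : ℕ} {ι : Type} {S S' : ℕ → Set (ι → ℕ)} (h : Good K S)
    (hS : ∀ t, 0 < t → ∀ x : ι → ℕ, (∀ i, x i < t ^ K) → (x ∈ S t ↔ x ∈ S' t)) : Good K S' := by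
  unfold Good at *
  convert h using 1
  ext z
  simp only [Set.mem_ofPred_eq]
  refine and_congr_right fun hz => ?_
  exact (hS _ hz.1 _ (val_lt hz)).symm

lemma Good.and {K : ℕ} {ι : Type} {p q : ℕ → (ι → ℕ) → Prop} (h : Good K (fun t => {x | p t x}))
    (h' : Good K (fun t => {x | q t x})) : Good K (fun t => {x | p t x ∧ q t x}) := by
  unfold Good at *
  convert h.inter h' using 1
  ext z
  simp only [Set.mem_ofPred_eq, Set.mem_inter_iff]
  tauto

lemma Good.not {K : ℕ} {ι : Type} [Finite ι] {p : ℕ → (ι → ℕ) → Prop}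
    (h : Good K (fun t => {x | p t x})) : Good K (fun t => {x | ¬ p t x}) := by
  unfold Good at *
  convert semi_cond.inter h.compl using 1
  ext z
  simp only [Set.mem_ofPred_eq, Set.mem_inter_iff, Set.mem_compl_iff]
  tauto

lemma Good.forall {K : ℕ} {ι α : Type} [Finite ι] [Finite α] {p : α → ℕ → (ι → ℕ) → Prop}
    (h : ∀ a, Good K (fun t => {x | p a t x})) : Good K (fun t => {x | ∀ a, p a t x}) := by
  unfold Good at *
  convert semi_cond.inter (semi_forall h) using 1
  ext z
  simp only [Set.mem_ofPred_eq, Set.mem_inter_iff]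
  constructor
  · rintro ⟨h1, h2⟩; exact ⟨h1, fun i => ⟨h1, h2 i⟩⟩
  · rintro ⟨h1, h2⟩; exact ⟨h1, fun i => (h2 i).2⟩

lemma Good.comp {K : ℕ} {ι ι' : Type} [Finite ι'] {p : ℕ → (ι → ℕ) → Prop}
    (h : Good K (fun t => {x | p t x})) (f : ι → ι') :
    Good K (fun t => {x : ι' → ℕ | p t (x ∘ f)}) := by
  unfold Good at *
  convert semi_cond.inter
    (h.preimage (LinearMap.funLeft ℕ ℕ (Option.map (Prod.map f (id : Fin K → Fin K))))) using 1
  ext z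
  simp only [Set.mem_ofPred_eq, Set.mem_inter_iff, Set.mem_preimage]
  refine and_congr_right fun hz => ?_
  have h1 : Cond (LinearMap.funLeft ℕ ℕ (Option.map (Prod.map f (id : Fin K → Fin K))) z) :=
    ⟨hz.1, fun _ => hz.2 _⟩
  exact ⟨fun h => ⟨h1, h⟩, fun h => h.2⟩

lemma Good.exists {K : ℕ} {ι κ : Type} {p : ℕ → (ι → ℕ) → (κ → ℕ) → Prop}
    (h : Good K (fun t => {x : ι ⊕ κ → ℕ | p t (x ∘ Sum.inl) (x ∘ Sum.inr)})) :
    Good K (fun t => {x : ι → ℕ | ∃ y : κ → ℕ, (∀ k, y k < t ^ K) ∧ p t x y}) := by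
  unfold Good at *
  convert h.image
    (LinearMap.funLeft ℕ ℕ (Option.map (Prod.map (Sum.inl : ι → ι ⊕ κ) (id : Fin K → Fin K))))
    using 1
  ext z
  simp only [Set.mem_ofPred_eq, Set.mem_image]
  constructor
  · rintro ⟨hz, y, hy, hp⟩
    refine ⟨fun v => match v with
      | none => z none
      | some (Sum.inl i, j) => z (some (i, j))
      | some (Sum.inr k, j) => enc K (z none) y (some (k, j)), ⟨⟨hz.1, ?_⟩, ?_⟩, ?_⟩
    · rintro ⟨i | k, j⟩
      · exact hz.2 _
      · exact (enc_cond hz.1 y).2 _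
    · convert hp using 1
      · rfl
      · exact val_enc y hy
    · funext v
      rcases v with _ | ⟨i, j⟩ <;> rfl
  · rintro ⟨w, ⟨hw, hp⟩, rfl⟩
    refine ⟨⟨hw.1, fun _ => hw.2 _⟩, val K w ∘ Sum.inr, fun k => val_lt hw _, hp⟩

lemma Good.lin {K : ℕ} {ι : Type} [Fintype ι] (Q : ι → Polynomial ℤ) (Q0 : Polynomial ℤ) :
    Good K (fun t => {x : ι → ℕ | ∑ i, (Q i).eval (t : ℤ) * (x i : ℤ) + Q0.eval (t : ℤ) = 0}) := by
  have hPL : PL (none : Option (ι × Fin K)) (fun z =>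
      ∑ i, (Q i).eval (z none : ℤ) * (val K z i : ℤ) + Q0.eval (z none : ℤ)) := by
    refine PL.add (PL.sum _ _ fun i _ => PL.polyMul ?_ (Q i)) ?_
    · have := PL.sum (τ := (none : Option (ι × Fin K))) (Finset.univ : Finset (Fin K)) _
        (fun j _ => (PL.coord (some (i, j))).tpow (j : ℕ))
      convert this using 2 with z
      simp only [val]
      push_cast
      exact Finset.sum_congr rfl fun j _ => by ring
    · simpa using (PL.const (τ := (none : Option (ι × Fin K))) 1).polyMul Q0
  unfold Good
  convert semi_cond.inter (hPL.semilinear 0) using 1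
  ext z
  simp only [Set.mem_ofPred_eq, Set.mem_inter_iff, add_zero]
  constructor
  · rintro ⟨h1, h2⟩
    refine ⟨h1, ⟨?_, h1.1⟩, h2⟩
    rintro (_ | v)
    · exact le_rfl
    · exact (h1.2 v).le
  · rintro ⟨h1, _, h2⟩
    exact ⟨h1, h2⟩

lemma Good.eq {K : ℕ} {ι : Type} [Finite ι] (i j : ι) :
    Good K (fun _ => {x : ι → ℕ | x i = x j}) := by
  have h := Good.lin (K := K) (ι := Fin 2) ![1, -1] 0
  have := h.comp ![i, j]
  convert this using 5
  simp
  omega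

lemma Good.lt {K : ℕ} {ι : Type} [Finite ι] (i j : ι) :
    Good K (fun _ => {x : ι → ℕ | x i < x j}) := by
  have h := Good.lin (K := K) (ι := Fin 3) ![1, 1, -1] 1
  have h1 := h.comp (ι' := ι ⊕ Unit) ![Sum.inl i, Sum.inr (), Sum.inl j]
  have h2 := Good.exists (K := K) (ι := ι) (κ := Unit)
    (p := fun _ x y => x i + y () + 1 = x j) (by
      convert h1 using 5
      simp [Fin.sum_univ_three]
      omega)
  refine h2.congr fun t _ x hx => ?_
  simp only [Set.mem_ofPred_eq]
  constructor
  · rintro ⟨y, _, hy⟩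
    omega
  · intro h
    refine ⟨fun _ => x j - x i - 1, fun _ => ?_, by dsimp only; omega⟩
    have := hx j
    dsimp only
    omega

lemma Good.count {K : ℕ} {ι κ : Type} [Finite ι] [Finite κ] {p : ℕ → (ι → ℕ) → (κ → ℕ) → Prop}
    (h : Good K (fun t => {x : ι ⊕ κ → ℕ | p t (x ∘ Sum.inl) (x ∘ Sum.inr)})) (c : ℕ) :
    Good K (fun t => {x : ι → ℕ | ∃ F : Fin c → (κ → ℕ), Function.Injective F ∧
      ∀ i, (∀ k, F i k < t ^ K) ∧ p t x (F i)}) := by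
  have h1 : Good K (fun t => {x : ι ⊕ (Fin c × κ) → ℕ |
      (∀ i : Fin c, p t (x ∘ Sum.inl) (fun k => x (Sum.inr (i, k)))) ∧
      (∀ ij : {ij : Fin c × Fin c // ij.1 ≠ ij.2},
        ¬ ∀ k, x (Sum.inr (ij.1.1, k)) = x (Sum.inr (ij.1.2, k)))}) := by
    refine Good.and (Good.forall fun i => ?_) (Good.forall fun ij => Good.not ?_)
    · exact h.comp (Sum.elim (fun a => Sum.inl a) (fun k => Sum.inr (i, k)))
    · exact Good.forall fun k => Good.eq _ _
  have h2 := Good.exists (K := K) (ι := ι) (κ := Fin c × κ)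
    (p := fun t x y => (∀ i : Fin c, p t x (fun k => y (i, k))) ∧
      (∀ ij : {ij : Fin c × Fin c // ij.1 ≠ ij.2}, ¬ ∀ k, y (ij.1.1, k) = y (ij.1.2, k))) h1
  refine h2.congr fun t _ x _ => ?_
  simp only [Set.mem_ofPred_eq]
  constructor
  · rintro ⟨y, hy, hp, hne⟩
    refine ⟨fun i k => y (i, k), fun i j hij => ?_, fun i => ⟨fun k => hy _, hp i⟩⟩
    by_contra hc
    exact hne ⟨(i, j), hc⟩ fun k => congrFun hij k
  · rintro ⟨F, hF, hp⟩
    refine ⟨fun ik => F ik.1 ik.2, fun ik => (hp ik.1).1 _, fun i => (hp i).2, ?_⟩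
    rintro ⟨⟨i, j⟩, hij⟩ hk
    exact hij (hF (funext hk))

end FML
namespace FML

lemma count_iff {α : Type} {A : Set α} (hA : A.Finite) (c : ℕ) :
    (∃ F : Fin c → α, Function.Injective F ∧ ∀ i, F i ∈ A) ↔ c ≤ A.ncard := by
  constructor
  · rintro ⟨F, hF, hm⟩
    have h1 : (Set.range F).ncard = c := by
      rw [← Set.image_univ, Set.ncard_image_of_injective _ hF, Set.ncard_univ]
      simp
    rw [← h1]
    exact Set.ncard_le_ncard (by rintro _ ⟨i, rfl⟩; exact hm i) hA
  · intro h
    rw [Set.ncard_eq_toFinset_card A hA] at h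
    refine ⟨fun i => (hA.toFinset.equivFin.symm (Fin.castLE h i) : α), ?_, fun i => ?_⟩
    · intro i j hij
      have := hA.toFinset.equivFin.symm.injective (Subtype.ext hij)
      exact Fin.castLE_injective h this
    · have := (hA.toFinset.equivFin.symm (Fin.castLE h i)).2
      exact hA.mem_toFinset.mp this

lemma gcd_repr {n : ℕ} (a : Fin n → ℤ) (i0 : Fin n) (ha : 0 < a i0) (k : ℤ)
    (hk : Finset.univ.gcd a ∣ k) :
    ∃ c : Fin n → ℕ, (∀ i, (c i : ℤ) < a i0) ∧ ∃ E : ℤ, k = ∑ i, (c i : ℤ) * a i + E * a i0 := by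
  obtain ⟨u, hu⟩ := Finset.gcd_eq_sum_mul Finset.univ a
  obtain ⟨q, rfl⟩ := hk
  refine ⟨fun i => ((q * u i) % a i0).toNat, fun i => ?_, ∑ i, ((q * u i) / a i0) * a i, ?_⟩
  · rw [Int.toNat_of_nonneg (Int.emod_nonneg _ ha.ne')]
    exact Int.emod_lt_of_pos _ ha
  · rw [hu, Finset.sum_mul, Finset.sum_mul, ← Finset.sum_add_distrib]
    refine Finset.sum_congr rfl fun i _ => ?_
    rw [Int.toNat_of_nonneg (Int.emod_nonneg _ ha.ne')]
    have := Int.emod_add_mul_ediv (q * u i) (a i0)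
    calc a i * u i * q = (q * u i) * a i := by ring
      _ = _ := by linear_combination (-(a i)) * this

lemma rep_le {n : ℕ} {a : Fin n → ℤ} (ha : ∀ i, 0 < a i) {k : ℤ} {b : Fin n → ℕ}
    (hb : k = ∑ i, (b i : ℤ) * a i) (i : Fin n) : (b i : ℤ) ≤ k := by
  rw [hb]
  have h1 : (b i : ℤ) * a i ≤ ∑ i, (b i : ℤ) * a i :=
    Finset.single_le_sum (f := fun i => (b i : ℤ) * a i)
      (fun j _ => mul_nonneg (by positivity) (ha j).le) (Finset.mem_univ i)
  have h2 : (b i : ℤ) ≤ (b i : ℤ) * a i := le_mul_of_one_le_right (by positivity) (ha i)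
  linarith

lemma rep_finite {n : ℕ} {a : Fin n → ℤ} (ha : ∀ i, 0 < a i) (k : ℤ) :
    {b : Fin n → ℕ | k = ∑ i, (b i : ℤ) * a i}.Finite := by
  refine (Set.finite_Iic (fun _ : Fin n => k.toNat)).subset fun b hb => ?_
  intro i
  have := rep_le ha hb i
  simp only
  omega

lemma frob_bound {n : ℕ} {a : Fin n → ℤ} (ha : ∀ i, 0 < a i) {i0 i1 : Fin n} (h01 : i0 ≠ i1)
    {m : ℕ} {X : ℤ} (hX : ∀ i, a i ≤ X) {k : ℤ} (hk : k ∈ frobSet a m) :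
    k < (n + m) * X ^ 2 := by
  by_contra hlt
  push Not at hlt
  obtain ⟨hg, hm⟩ := hk
  refine absurd hm (not_lt.mpr ?_)
  obtain ⟨c, hc, E, hE⟩ := gcd_repr a i0 (ha i0) k hg
  have hX0 : 0 < X := (ha i0).trans_le (hX i0)
  have h1 : ∑ i, (c i : ℤ) * a i ≤ n * X ^ 2 := by
    have : ∑ i : Fin n, (c i : ℤ) * a i ≤ ∑ i : Fin n, X ^ 2 := by
      refine Finset.sum_le_sum fun i _ => ?_
      rw [sq]
      exact mul_le_mul ((hc i).le.trans (hX i0)) (hX i) (ha i).le hX0.le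
    simpa using this
  have h2 : (m * a i1) * a i0 ≤ E * a i0 := by
    have : (m * a i1) * a i0 ≤ m * X ^ 2 := by
      rw [mul_assoc, sq]
      exact mul_le_mul_of_nonneg_left (mul_le_mul (hX i1) (hX i0) (ha i0).le hX0.le)
        (by positivity)
    linarith
  have h3 : m * a i1 ≤ E := le_of_mul_le_mul_right h2 (ha i0)
  unfold repCount
  rw [← count_iff (rep_finite ha k)]
  have hEj : ∀ j : Fin m, 0 ≤ E - j * a i1 := fun j => by
    have : (j : ℤ) * a i1 ≤ m * a i1 :=
      mul_le_mul_of_nonneg_right (by exact_mod_cast j.2.le) (ha i1).le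
    linarith
  refine ⟨fun j => c + Pi.single i0 (E - j * a i1).toNat + Pi.single i1 (j * (a i0).toNat),
    fun j j' hjj => ?_, fun j => ?_⟩
  · have := congrFun hjj i1
    simp only [Pi.add_apply, Pi.single_eq_same, Pi.single_eq_of_ne h01.symm] at this
    have h4 : (j : ℕ) * (a i0).toNat = j' * (a i0).toNat := by omega
    have h5 : 0 < (a i0).toNat := by have := ha i0; omega
    exact Fin.ext (Nat.eq_of_mul_eq_mul_right h5 h4)
  · simp only [Set.mem_ofPred_eq, Pi.add_apply]
    push_cast
    simp only [add_mul, Finset.sum_add_distrib]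
    have hs : ∀ (i : Fin n) (x : ℕ), ∑ l, ((Pi.single i x : Fin n → ℕ) l : ℤ) * a l = x * a i := by
      intro i x
      rw [Finset.sum_eq_single i]
      · simp
      · intro l _ hl; simp [Pi.single_eq_of_ne hl]
      · simp
    rw [hs, hs, hE]
    push_cast
    rw [Int.toNat_of_nonneg (hEj j), Int.toNat_of_nonneg (ha i0).le]
    ring

lemma neg_mem_frob {n : ℕ} {a : Fin n → ℤ} (ha : ∀ i, 0 < a i) (i0 : Fin n) {m : ℕ} (hm : 0 < m)
    (j : ℕ) : -((j : ℤ) + 1) * a i0 ∈ frobSet a m := by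
  refine ⟨Dvd.dvd.mul_left (Finset.gcd_dvd (Finset.mem_univ i0)) _, ?_⟩
  have : {b : Fin n → ℕ | -((j : ℤ) + 1) * a i0 = ∑ i, (b i : ℤ) * a i} = ∅ := by
    rw [Set.eq_empty_iff_forall_notMem]
    intro b hb
    have h1 : (0 : ℤ) ≤ ∑ i, (b i : ℤ) * a i :=
      Finset.sum_nonneg fun i _ => mul_nonneg (by positivity) (ha i).le
    have h2 : 0 < ((j : ℤ) + 1) * a i0 := mul_pos (by positivity) (ha i0)
    rw [Set.mem_ofPred_eq] at hb
    linarith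
  unfold repCount
  rw [this]
  simpa using hm

lemma gcd_iff {n : ℕ} {a : Fin n → ℤ} (ha : ∀ i, 0 < a i) (i0 : Fin n) {X : ℤ}
    (hX : ∀ i, a i ≤ X) {B l : ℕ} (hB : (n + 1) * X ^ 2 < B) {x : ℕ} (hx : x < B) :
    Finset.univ.gcd a ∣ (x : ℤ) - l * a i0 ↔ ∃ y : Fin n ⊕ Bool → ℕ, (∀ k, y k < B) ∧
      (x : ℤ) + y (Sum.inr true) * a i0 =
        ∑ i, (y (Sum.inl i) : ℤ) * a i + y (Sum.inr false) * a i0 := by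
  have hX0 : 0 < X := (ha i0).trans_le (hX i0)
  have hd : Finset.univ.gcd a ∣ a i0 := Finset.gcd_dvd (Finset.mem_univ i0)
  rw [dvd_sub_left (Dvd.dvd.mul_left hd _)]
  constructor
  · intro hg
    obtain ⟨c, hc, E, hE⟩ := gcd_repr a i0 (ha i0) _ hg
    have h1 : ∑ i, (c i : ℤ) * a i ≤ n * X ^ 2 := by
      have : ∑ i : Fin n, (c i : ℤ) * a i ≤ ∑ i : Fin n, X ^ 2 := by
        refine Finset.sum_le_sum fun i _ => ?_
        rw [sq]
        exact mul_le_mul ((hc i).le.trans (hX i0)) (hX i) (ha i).le hX0.le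
      simpa using this
    have h0 : 0 ≤ ∑ i, (c i : ℤ) * a i :=
      Finset.sum_nonneg fun i _ => mul_nonneg (by positivity) (ha i).le
    have hXX : X ≤ X ^ 2 := by nlinarith
    have hnX : (0 : ℤ) ≤ n * X ^ 2 := by positivity
    have hE1 : |E| ≤ |E * a i0| := by
      rw [abs_mul]
      exact le_mul_of_one_le_right (abs_nonneg _) (le_trans (ha i0) (le_abs_self _))
    have hE2 : |E * a i0| < B := by
      rw [abs_lt]
      constructor <;> linarith
    have hE3 := abs_lt.mp (hE1.trans_lt hE2)
    refine ⟨Sum.elim c (fun b => bif b then (-E).toNat else E.toNat), ?_, ?_⟩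
    · rintro (i | b)
      · have := hc i
        have := hX i0
        have : ((c i : ℕ) : ℤ) < B := by linarith
        simpa using this
      · cases b
        · simp only [Sum.elim_inr, cond_false]; omega
        · simp only [Sum.elim_inr, cond_true]; omega
    · simp only [Sum.elim_inr, cond_true, cond_false, Sum.elim_inl]
      have : (E.toNat : ℤ) = E + (-E).toNat := by omega
      rw [this, hE]
      ring
  · rintro ⟨y, -, hy⟩
    have : (x : ℤ) = ∑ i, (y (Sum.inl i) : ℤ) * a i + y (Sum.inr false) * a i0
      - y (Sum.inr true) * a i0 := by linarith
    rw [this]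
    refine dvd_sub (dvd_add (Finset.dvd_sum fun i hi => ?_) (Dvd.dvd.mul_left hd _))
      (Dvd.dvd.mul_left hd _)
    exact Dvd.dvd.mul_left (Finset.gcd_dvd hi) _

lemma rep_iff {n : ℕ} {a : Fin n → ℤ} (ha : ∀ i, 0 < a i) (i0 : Fin n)
    {B l m : ℕ} {x : ℕ} (hx : x < B) :
    m ≤ repCount a ((x : ℤ) - l * a i0) ↔ ∃ F : Fin m → (Fin n → ℕ), Function.Injective F ∧
      ∀ i, (∀ k, F i k < B) ∧ (x : ℤ) = ∑ j, (F i j : ℤ) * a j + l * a i0 := by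
  unfold repCount
  rw [← count_iff (rep_finite ha _)]
  refine exists_congr fun F => and_congr_right fun _ => forall_congr' fun i => ?_
  rw [Set.mem_ofPred_eq]
  constructor
  · intro h
    refine ⟨fun k => ?_, by linarith⟩
    have h1 := rep_le ha h k
    have h2 : (0 : ℤ) ≤ l * a i0 := mul_nonneg (by positivity) (ha i0).le
    have : ((F i k : ℕ) : ℤ) < B := by
      have : (x : ℤ) < B := by exact_mod_cast hx
      linarith
    exact_mod_cast this
  · rintro ⟨_, h⟩
    linarith

lemma upper_finite {S : Set ℤ} {b : ℤ} (hS : ∀ k ∈ S, k < b) (d : ℤ) :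
    {j ∈ S | d < j}.Finite :=
  (Set.finite_Ioo d b).subset fun j hj => ⟨hj.2, hS j hj.1⟩

lemma shift_nonneg {S : Set ℤ} {s : ℤ} (hs : 0 < s) (hneg : ∀ j : ℕ, -((j : ℤ) + 1) * s ∈ S)
    {b : ℤ} (hS : ∀ k ∈ S, k < b) {D : ℤ} {l : ℕ} (hl : 0 < l)
    (hD : {j ∈ S | D < j}.ncard = l - 1) : 0 ≤ D + l * s := by
  by_contra hlt
  push Not at hlt
  have : l ≤ {j ∈ S | D < j}.ncard := by
    rw [← count_iff (upper_finite hS D)]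
    refine ⟨fun j => -(((j : ℕ) : ℤ) + 1) * s, fun j j' h => ?_, fun j => ⟨hneg _, ?_⟩⟩
    · have := mul_right_cancel₀ hs.ne' h
      exact Fin.ext (by omega)
    · have : (((j : ℕ) : ℤ) + 1) * s ≤ l * s :=
        mul_le_mul_of_nonneg_right (by have := j.2; omega) hs.le
      linarith
  omega

lemma count_shift {S : Set ℤ} {σ : ℤ} {B : ℕ} (hS : ∀ k ∈ S, k + σ < B) (x : ℕ) (c : ℕ) :
    (∃ F : Fin c → (Unit → ℕ), Function.Injective F ∧
      ∀ i, (∀ k, F i k < B) ∧ ((F i () : ℤ) - σ ∈ S ∧ x < F i ())) ↔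
    c ≤ {j ∈ S | (x : ℤ) - σ < j}.ncard := by
  rw [← count_iff (upper_finite (b := B - σ) (fun k hk => by linarith [hS k hk]) _)]
  constructor
  · rintro ⟨F, hF, h⟩
    refine ⟨fun i => (F i () : ℤ) - σ, fun i j hij => hF ?_, fun i => ⟨(h i).2.1, ?_⟩⟩
    · funext u
      have : F i () = F j () := by simp only at hij; omega
      exact this
    · have := (h i).2.2
      simp only
      omega
  · rintro ⟨F, hF, h⟩
    have hn : ∀ i, (((F i + σ).toNat : ℕ) : ℤ) = F i + σ := fun i => by
      have := (h i).2
      omega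
    refine ⟨fun i _ => (F i + σ).toNat, fun i j hij => hF ?_, fun i => ⟨fun _ => ?_, ?_, ?_⟩⟩
    · have h1 := congrFun hij ()
      have h2 := hn i
      have h3 := hn j
      simp only at h1
      omega
    · have h1 := hS _ (h i).1
      have h2 := hn i
      simp only
      omega
    · simp only [hn]
      simpa using (h i).1
    · have h1 := (h i).2
      have h2 := hn i
      simp only
      omega

lemma final_iff {S : Set ℤ} {σ : ℤ} {B : ℕ} (hS : ∀ k ∈ S, k + σ < B) {D : ℤ} {l : ℕ} (hl : 0 < l)
    (hDS : D ∈ S) (hD : {j ∈ S | D < j}.ncard = l - 1) (hnn : 0 ≤ D + σ) (x : ℕ) :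
    ((x : ℤ) - σ ∈ S ∧
      ((∃ F : Fin (l - 1) → (Unit → ℕ), Function.Injective F ∧
        ∀ i, (∀ k, F i k < B) ∧ ((F i () : ℤ) - σ ∈ S ∧ x < F i ())) ∧
      ¬ (∃ F : Fin l → (Unit → ℕ), Function.Injective F ∧
        ∀ i, (∀ k, F i k < B) ∧ ((F i () : ℤ) - σ ∈ S ∧ x < F i ())))) ↔
    x = (D + σ).toNat := by
  rw [count_shift hS, count_shift hS]
  have hfin : ∀ d, {j ∈ S | d < j}.Finite :=
    upper_finite (b := B - σ) (fun k hk => by linarith [hS k hk])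
  constructor
  · rintro ⟨h1, h2, h3⟩
    suffices (x : ℤ) - σ = D by omega
    have mono : ∀ d d' : ℤ, d' ∈ S → d < d' →
        {j ∈ S | d' < j}.ncard < {j ∈ S | d < j}.ncard := by
      intro d d' hd' hdd
      refine Set.ncard_lt_ncard ?_ (hfin d)
      refine ⟨fun j hj => ⟨hj.1, hdd.trans hj.2⟩, fun hsub => ?_⟩
      exact lt_irrefl _ (hsub (⟨hd', hdd⟩ : d' ∈ {j ∈ S | d < j})).2
    rcases lt_trichotomy ((x : ℤ) - σ) D with h | h | h
    · have := mono _ _ hDS h; omega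
    · exact h
    · have := mono _ _ h1 h; omega
  · rintro rfl
    have : (((D + σ).toNat : ℕ) : ℤ) - σ = D := by omega
    rw [this, hD]
    exact ⟨hDS, le_rfl, by omega⟩

end FML

namespace FML

lemma Good.extract {K : ℕ} {S : ℕ → Set (Unit → ℕ)} (h : Good K S) (f : ℕ → ℕ) (N0 : ℕ)
    (hf : ∀ t, N0 ≤ t → f t < t ^ K ∧
      ∀ x : Unit → ℕ, (∀ i, x i < t ^ K) → (x ∈ S t ↔ x () = f t)) :
    IsEQP (fun t => (f t : ℤ)) := by
  obtain ⟨M, hM, N, hp⟩ := pump none h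
  set N1 := N + N0 + 1 with hN1
  have key : ∀ r : ℕ, ∃ R : Polynomial ℚ, ∀ s : ℕ,
      (f (r + M * N1 + M * s) : ℚ) = R.eval ((r + M * N1 + M * s : ℕ) : ℚ) := by
    intro r
    set t0 := r + M * N1 with ht0
    have hle : N1 ≤ t0 := (Nat.le_mul_of_pos_left N1 hM).trans (Nat.le_add_left _ _)
    have ht0pos : 0 < t0 := by omega
    obtain ⟨hlt, hiff⟩ := hf t0 (by omega)
    obtain ⟨v, hv, hs⟩ := hp (enc K t0 (fun _ => f t0)) (by
      refine ⟨enc_cond ht0pos _, ?_⟩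
      rw [val_enc _ (fun _ => hlt)]
      exact (hiff _ (fun _ => hlt)).2 rfl) (by change N ≤ t0; omega)
    set z := enc K t0 (fun _ : Unit => f t0) with hz
    refine ⟨∑ j : Fin K, (Polynomial.C (z (some ((), j)) : ℚ) +
      Polynomial.C (v (some ((), j)) : ℚ) * (Polynomial.C ((M : ℚ)⁻¹) *
        (Polynomial.X - Polynomial.C (t0 : ℚ)))) * Polynomial.X ^ (j : ℕ), fun s => ?_⟩
    obtain ⟨hc, hm⟩ := hs s
    have hnone : (z + s • v) none = t0 + M * s := by
      simp only [Pi.add_apply, Pi.smul_apply, hv, smul_eq_mul, mul_comm s M]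
      rfl
    have h1 := ((hf _ (by omega : N0 ≤ t0 + M * s)).2 (val K (z + s • v))
      (fun i => by rw [← hnone]; exact val_lt hc i)).1 (by rw [← hnone]; exact hm)
    rw [← h1]
    simp only [val, hnone, Polynomial.eval_finsetSum]
    push_cast
    refine Finset.sum_congr rfl fun j _ => ?_
    have hM' : (M : ℚ) ≠ 0 := by exact_mod_cast hM.ne'
    simp
    field_simp
    exact Or.inl trivial
  choose R hR using key
  refine ⟨M, hM, R, M * (N1 + 1), fun t ht => ?_⟩
  have h1 : t = t % M + M * N1 + M * (t / M - N1) := by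
    have h2 := Nat.mod_add_div t M
    have h3 : N1 + 1 ≤ t / M := (Nat.le_div_iff_mul_le hM).2 (by rwa [mul_comm])
    have h4 : t / M = N1 + (t / M - N1) := by omega
    rw [add_assoc, ← mul_add, ← h4, h2]
  have := hR (t % M) (t / M - N1)
  rw [← h1] at this
  exact_mod_cast this

lemma IsEQP.sub_poly {f : ℕ → ℤ} (hf : IsEQP f) {D : ℕ → ℤ} (P : Polynomial ℚ) (N : ℕ)
    (h : ∀ t, N ≤ t → (D t : ℚ) = f t - P.eval (t : ℚ)) : IsEQP D := by
  obtain ⟨d, hd, R, N', hR⟩ := hf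
  refine ⟨d, hd, fun r => R r - P, max N N', fun t ht => ?_⟩
  rw [h t (le_trans (le_max_left _ _) ht), hR t (le_trans (le_max_right _ _) ht),
    Polynomial.eval_sub]

lemma poly_le (P : Polynomial ℚ) : ∃ d N : ℕ, ∀ t : ℕ, N ≤ t → P.eval (t : ℚ) ≤ (t : ℚ) ^ d := by
  obtain ⟨N, hN⟩ := exists_nat_ge (∑ j ∈ Finset.range (P.natDegree + 1), |P.coeff j|)
  refine ⟨P.natDegree + 1, N + 1, fun t ht => ?_⟩
  have ht1 : (1 : ℚ) ≤ t := by exact_mod_cast (by omega : 1 ≤ t)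
  have htN : (N : ℚ) ≤ t := by exact_mod_cast (by omega : N ≤ t)
  rw [Polynomial.eval_eq_sum_range]
  calc ∑ i ∈ Finset.range (P.natDegree + 1), P.coeff i * (t : ℚ) ^ i
      ≤ ∑ i ∈ Finset.range (P.natDegree + 1), |P.coeff i| * (t : ℚ) ^ P.natDegree := by
        refine Finset.sum_le_sum fun i hi => ?_
        refine mul_le_mul (le_abs_self _) (pow_le_pow_right₀ ht1 ?_) (by positivity) (abs_nonneg _)
        have := Finset.mem_range.mp hi
        omega
    _ = (∑ i ∈ Finset.range (P.natDegree + 1), |P.coeff i|) * (t : ℚ) ^ P.natDegree := by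
        rw [Finset.sum_mul]
    _ ≤ t * (t : ℚ) ^ P.natDegree := by
        exact mul_le_mul_of_nonneg_right (hN.trans htN) (by positivity)
    _ = _ := by ring

lemma poly_pos (P : Polynomial ℚ) (hP : 0 < P.leadingCoeff) :
    ∃ N : ℕ, ∀ t : ℕ, N ≤ t → 0 < P.eval (t : ℚ) := by
  rcases le_or_gt P.degree 0 with h | h
  · rw [Polynomial.eq_C_of_degree_le_zero h] at hP ⊢
    exact ⟨0, fun t _ => by simpa using hP⟩
  · have := (P.tendsto_atTop_of_leadingCoeff_nonneg h hP.le).comp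
      (tendsto_natCast_atTop_atTop (R := ℚ))
    have := this.eventually_gt_atTop 0
    obtain ⟨N, hN⟩ := Filter.eventually_atTop.mp this
    exact ⟨N, fun t ht => hN t ht⟩

lemma poly_den (P : Polynomial ℚ) : ∃ den : ℤ, 0 < den ∧ ∃ Q : Polynomial ℤ, ∀ t : ℕ,
    ((Q.eval (t : ℤ) : ℤ) : ℚ) = den * P.eval (t : ℚ) := by
  induction P using Polynomial.induction_on' with
  | add p q hp hq =>
    obtain ⟨d, hd, Q, hQ⟩ := hp
    obtain ⟨d', hd', Q', hQ'⟩ := hq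
    refine ⟨d * d', by positivity, Polynomial.C d' * Q + Polynomial.C d * Q', fun t => ?_⟩
    simp only [Polynomial.eval_add, Polynomial.eval_mul, Polynomial.eval_C]
    push_cast
    rw [hQ, hQ']
    ring
  | monomial k a =>
    refine ⟨a.den, by exact_mod_cast a.den_pos, Polynomial.monomial k a.num, fun t => ?_⟩
    simp only [Polynomial.eval_monomial]
    push_cast
    have := Rat.mul_den_eq_num a
    rw [← this]
    ring

lemma common_den {n : ℕ} (P : Fin n → Polynomial ℚ) :
    ∃ den : ℤ, 0 < den ∧ ∃ Q : Fin n → Polynomial ℤ, ∀ i, ∀ t : ℕ,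
    (((Q i).eval (t : ℤ) : ℤ) : ℚ) = den * (P i).eval (t : ℚ) := by
  choose d hd Q hQ using fun i => poly_den (P i)
  refine ⟨∏ i, d i, Finset.prod_pos fun i _ => hd i,
    fun i => Polynomial.C (∏ j ∈ Finset.univ.erase i, d j) * Q i, fun i t => ?_⟩
  simp only [Polynomial.eval_mul, Polynomial.eval_C]
  rw [← Finset.prod_erase_mul Finset.univ d (Finset.mem_univ i)]
  push_cast
  rw [hQ]
  ring

lemma unif {n : ℕ} {p : Fin n → ℕ → Prop} (h : ∀ i, ∃ N : ℕ, ∀ t, N ≤ t → p i t) :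
    ∃ N : ℕ, ∀ t, N ≤ t → ∀ i, p i t := by
  choose N hN using h
  exact ⟨Finset.univ.sup N, fun t ht i => hN i t ((Finset.le_sup (Finset.mem_univ i)).trans ht)⟩

/-- definability of the (shifted) set -/
def GP {n : ℕ} (Q : Fin n → Polynomial ℤ) (i0 : Fin n) (den : ℤ) (K t : ℕ) (x : Unit → ℕ) : Prop :=
  ∃ y : Fin n ⊕ Bool → ℕ, (∀ k, y k < t ^ K) ∧
    den * (x () : ℤ) + (Q i0).eval (t : ℤ) * y (Sum.inr true) =
      ∑ i, (Q i).eval (t : ℤ) * (y (Sum.inl i) : ℤ) + (Q i0).eval (t : ℤ) * y (Sum.inr false)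

lemma good_GP {n : ℕ} (Q : Fin n → Polynomial ℤ) (i0 : Fin n) (den : ℤ) (K : ℕ) :
    Good K (fun t => {x | GP Q i0 den K t x}) := by
  unfold GP
  refine Good.exists ?_
  have := Good.lin (K := K) (ι := Unit ⊕ (Fin n ⊕ Bool))
    (Sum.elim (fun _ => Polynomial.C den) (Sum.elim (fun i => - Q i)
      (fun b => bif b then Q i0 else - Q i0))) 0
  refine this.congr fun t _ x _ => ?_
  simp only [Set.mem_ofPred_eq, Fintype.sum_sum_type, Fintype.sum_bool, Sum.elim_inl, Sum.elim_inr,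
    cond_true, cond_false, Polynomial.eval_C, Polynomial.eval_neg, Polynomial.eval_zero,
    Finset.univ_unique, Finset.sum_singleton, neg_mul, Finset.sum_neg_distrib, Function.comp]
  constructor <;> intro h <;> linarith

/-- there are at least `m` representations -/
def RP {n : ℕ} (Q : Fin n → Polynomial ℤ) (i0 : Fin n) (den : ℤ) (l m K t : ℕ) (x : Unit → ℕ) :
    Prop :=
  ∃ F : Fin m → (Fin n → ℕ), Function.Injective F ∧ ∀ i, (∀ k, F i k < t ^ K) ∧
    den * (x () : ℤ) = ∑ j, (Q j).eval (t : ℤ) * (F i j : ℤ) + l * (Q i0).eval (t : ℤ)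

lemma good_RP {n : ℕ} (Q : Fin n → Polynomial ℤ) (i0 : Fin n) (den : ℤ) (l m K : ℕ) :
    Good K (fun t => {x | RP Q i0 den l m K t x}) := by
  unfold RP
  refine Good.count (p := fun t x y => den * (x () : ℤ) =
    ∑ j, (Q j).eval (t : ℤ) * (y j : ℤ) + l * (Q i0).eval (t : ℤ)) ?_ m
  have := Good.lin (K := K) (ι := Unit ⊕ Fin n)
    (Sum.elim (fun _ => Polynomial.C den) (fun i => - Q i)) (- (Polynomial.C (l : ℤ) * Q i0))
  refine this.congr fun t _ x _ => ?_
  simp only [Set.mem_ofPred_eq, Fintype.sum_sum_type, Sum.elim_inl, Sum.elim_inr,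
    Polynomial.eval_C, Polynomial.eval_neg, Polynomial.eval_mul,
    Finset.univ_unique, Finset.sum_singleton, neg_mul, Finset.sum_neg_distrib, Function.comp]
  constructor <;> intro h <;> linarith

/-- the shifted set -/
def TP {n : ℕ} (Q : Fin n → Polynomial ℤ) (i0 : Fin n) (den : ℤ) (l m K t : ℕ) (x : Unit → ℕ) :
    Prop := GP Q i0 den K t x ∧ ¬ RP Q i0 den l m K t x

lemma good_TP {n : ℕ} (Q : Fin n → Polynomial ℤ) (i0 : Fin n) (den : ℤ) (l m K : ℕ) :
    Good K (fun t => {x | TP Q i0 den l m K t x}) :=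
  (good_GP Q i0 den K).and (good_RP Q i0 den l m K).not

lemma TP_iff {n : ℕ} (Q : Fin n → Polynomial ℤ) (i0 : Fin n) {den : ℤ} (hden : 0 < den)
    (l m K t : ℕ) (x : Unit → ℕ) {a : Fin n → ℤ} (ha : ∀ i, 0 < a i)
    (hQ : ∀ i, (Q i).eval (t : ℤ) = den * a i) {X : ℤ} (hX : ∀ i, a i ≤ X)
    (hB : (n + 1) * X ^ 2 < ((t ^ K : ℕ) : ℤ)) (hx : ∀ i, x i < t ^ K) :
    TP Q i0 den l m K t x ↔ (x () : ℤ) - l * a i0 ∈ frobSet a m := by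
  have e1 : GP Q i0 den K t x ↔ Finset.univ.gcd a ∣ (x () : ℤ) - l * a i0 := by
    rw [gcd_iff ha i0 hX hB (hx ())]
    refine exists_congr fun y => and_congr_right fun _ => ?_
    have : den * (x () : ℤ) + (Q i0).eval (t : ℤ) * y (Sum.inr true) =
        den * ((x () : ℤ) + y (Sum.inr true) * a i0) := by rw [hQ]; ring
    rw [this]
    have : ∑ i, (Q i).eval (t : ℤ) * (y (Sum.inl i) : ℤ) +
        (Q i0).eval (t : ℤ) * y (Sum.inr false) =
        den * (∑ i, (y (Sum.inl i) : ℤ) * a i + y (Sum.inr false) * a i0) := by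
      rw [mul_add, Finset.mul_sum]
      congr 1
      · exact Finset.sum_congr rfl fun i _ => by rw [hQ]; ring
      · rw [hQ]; ring
    rw [this]
    exact mul_right_inj' hden.ne'
  have e2 : RP Q i0 den l m K t x ↔ m ≤ repCount a ((x () : ℤ) - l * a i0) := by
    rw [rep_iff ha i0 (hx ())]
    refine exists_congr fun F => and_congr_right fun _ => forall_congr' fun i =>
      and_congr_right fun _ => ?_
    have : ∑ j, (Q j).eval (t : ℤ) * (F i j : ℤ) + l * (Q i0).eval (t : ℤ) =
        den * (∑ j, (F i j : ℤ) * a j + l * a i0) := by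
      rw [mul_add, Finset.mul_sum]
      congr 1
      · exact Finset.sum_congr rfl fun i _ => by rw [hQ]; ring
      · rw [hQ]; ring
    rw [this]
    exact mul_right_inj' hden.ne'
  unfold TP
  rw [e1, e2, not_le]
  rfl

/-- shifted `l`-th largest element -/
def LP {n : ℕ} (Q : Fin n → Polynomial ℤ) (i0 : Fin n) (den : ℤ) (l m K t : ℕ) (x : Unit → ℕ) :
    Prop :=
  TP Q i0 den l m K t x ∧
    ((∃ F : Fin (l - 1) → (Unit → ℕ), Function.Injective F ∧
      ∀ i, (∀ k, F i k < t ^ K) ∧ (TP Q i0 den l m K t (F i) ∧ x () < F i ())) ∧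
    ¬ (∃ F : Fin l → (Unit → ℕ), Function.Injective F ∧
      ∀ i, (∀ k, F i k < t ^ K) ∧ (TP Q i0 den l m K t (F i) ∧ x () < F i ())))

lemma good_LP {n : ℕ} (Q : Fin n → Polynomial ℤ) (i0 : Fin n) (den : ℤ) (l m K : ℕ) :
    Good K (fun t => {x | LP Q i0 den l m K t x}) := by
  have h : Good K (fun t => {x : Unit ⊕ Unit → ℕ |
      TP Q i0 den l m K t (x ∘ Sum.inr) ∧ (x ∘ Sum.inl) () < (x ∘ Sum.inr) ()}) :=
    Good.and ((good_TP Q i0 den l m K).comp Sum.inr) (Good.lt (Sum.inl ()) (Sum.inr ()))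
  exact (good_TP Q i0 den l m K).and ((Good.count (p := fun t x y =>
    TP Q i0 den l m K t y ∧ x () < y ()) h (l - 1)).and (Good.count (p := fun t x y =>
    TP Q i0 den l m K t y ∧ x () < y ()) h l).not)

end FML

/-- `t ↦ F_{m,ℓ}(P₁(t), …, Pₙ(t))` is eventually quasi-polynomial.
Here `a i t` is the (integer) value `Pᵢ(t)` and `D t` is characterized as the `ℓ`-th
largest element of the set of multiples of the gcd with fewer than `m` representations. -/
theorem F_ml_eqp (n m ℓ : ℕ) (hn : 2 ≤ n) (hm : 0 < m) (hl : 0 < ℓ)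
    (P : Fin n → Polynomial ℚ)
    (hint : ∀ i, ∀ z : ℤ, ∃ w : ℤ, (P i).eval (z : ℚ) = (w : ℚ))
    (hlead : ∀ i, 0 < (P i).leadingCoeff)
    (a : Fin n → ℕ → ℤ)
    (ha : ∃ N : ℕ, ∀ t : ℕ, N ≤ t → ∀ i, (a i t : ℚ) = (P i).eval (t : ℚ))
    (D : ℕ → ℤ)
    (hD : ∃ N : ℕ, ∀ t : ℕ, N ≤ t →
      D t ∈ frobSet (fun i => a i t) m ∧
      {j ∈ frobSet (fun i => a i t) m | D t < j}.ncard = ℓ - 1) :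
    IsEQP D := by
  have hn0 : 0 < n := by omega
  have hn1 : 1 < n := by omega
  let i0 : Fin n := ⟨0, hn0⟩
  let i1 : Fin n := ⟨1, hn1⟩
  have h01 : i0 ≠ i1 := by simp [i0, i1]
  obtain ⟨den, hden, Q, hQ⟩ := FML.common_den P
  obtain ⟨Na, hNa⟩ := ha
  obtain ⟨ND, hND⟩ := hD
  obtain ⟨Np, hNp⟩ := FML.unif (fun i => FML.poly_pos (P i) (hlead i))
  choose d hd using fun i => FML.poly_le (P i)
  obtain ⟨Nb, hNb⟩ := FML.unif hd
  set e := Finset.univ.sup d with he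
  set N := Na + ND + Np + Nb + n + m + ℓ + 2 with hN
  -- facts for large `t`
  have hpos : ∀ t, N ≤ t → ∀ i, 0 < a i t := fun t ht i => by
    have h1 := hNp t (by omega) i
    rw [← hNa t (by omega) i] at h1
    exact_mod_cast h1
  have hX : ∀ t, N ≤ t → ∀ i, a i t ≤ (t : ℤ) ^ e := fun t ht i => by
    have h1 := hNb t (by omega) i
    rw [← hNa t (by omega) i] at h1
    have h2 : a i t ≤ (t : ℤ) ^ d i := by exact_mod_cast h1
    exact h2.trans (pow_le_pow_right₀ (by omega) (Finset.le_sup (Finset.mem_univ i)))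
  have hQa : ∀ t, N ≤ t → ∀ i, (Q i).eval (t : ℤ) = den * a i t := fun t ht i => by
    have h1 := hQ i t
    rw [← hNa t (by omega) i] at h1
    exact_mod_cast h1
  have hpow : ∀ t : ℕ, N ≤ t →
      ((n : ℤ) + m + ℓ + 1) * ((t : ℤ) ^ e) ^ 2 < ((t ^ (2 * e + 1) : ℕ) : ℤ) := fun t ht => by
    have h1 : ((n : ℤ) + m + ℓ + 1) < t := by omega
    have h2 : (0 : ℤ) < ((t : ℤ) ^ e) ^ 2 := by
      have : (0 : ℤ) < t := by omega
      positivity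
    push_cast
    calc ((n : ℤ) + m + ℓ + 1) * ((t : ℤ) ^ e) ^ 2 < t * ((t : ℤ) ^ e) ^ 2 :=
          mul_lt_mul_of_pos_right h1 h2
      _ = _ := by ring
  have hsq : ∀ t : ℕ, N ≤ t → (t : ℤ) ^ e ≤ ((t : ℤ) ^ e) ^ 2 := fun t ht => by
    have : (1 : ℤ) ≤ (t : ℤ) ^ e := one_le_pow₀ (by omega)
    exact le_self_pow₀ this (by norm_num)
  have hSb : ∀ t, N ≤ t → ∀ k ∈ frobSet (fun i => a i t) m,
      k + ℓ * a i0 t < ((t ^ (2 * e + 1) : ℕ) : ℤ) := fun t ht k hk => by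
    have h1 := FML.frob_bound (hpos t ht) h01 (hX t ht) hk
    have h2 := hpow t ht
    have h3 : (ℓ : ℤ) * a i0 t ≤ ℓ * ((t : ℤ) ^ e) ^ 2 :=
      mul_le_mul_of_nonneg_left ((hX t ht i0).trans (hsq t ht)) (by positivity)
    have h4 : (0 : ℤ) ≤ ((t : ℤ) ^ e) ^ 2 := by positivity
    linarith
  have hnn : ∀ t, N ≤ t → 0 ≤ D t + ℓ * a i0 t := fun t ht => by
    refine FML.shift_nonneg (hpos t ht i0)
      (fun j => FML.neg_mem_frob (a := fun i => a i t) (hpos t ht) i0 hm j)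
      (b := ((t ^ (2 * e + 1) : ℕ) : ℤ) - ℓ * a i0 t) (fun k hk => ?_) hl (hND t (by omega)).2
    have := hSb t ht k hk
    linarith
  have hTP : ∀ t, N ≤ t → ∀ x : Unit → ℕ, (∀ i, x i < t ^ (2 * e + 1)) →
      (FML.TP Q i0 den ℓ m (2 * e + 1) t x ↔
        (x () : ℤ) - ℓ * a i0 t ∈ frobSet (fun i => a i t) m) := fun t ht x hx => by
    refine FML.TP_iff Q i0 hden ℓ m _ t x (hpos t ht) (hQa t ht) (hX t ht) ?_ hx
    have h2 := hpow t ht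
    have h4 : (0 : ℤ) ≤ ((m : ℤ) + ℓ) * ((t : ℤ) ^ e) ^ 2 := by positivity
    linarith
  have hEQP : IsEQP (fun t => (((D t + ℓ * a i0 t).toNat : ℕ) : ℤ)) := by
    refine FML.Good.extract (FML.good_LP Q i0 den ℓ m (2 * e + 1)) _ N fun t ht => ⟨?_, ?_⟩
    · have h1 := hSb t ht _ (hND t (by omega)).1
      have h2 := hnn t ht
      have h3 : (((D t + ℓ * a i0 t).toNat : ℕ) : ℤ) < ((t ^ (2 * e + 1) : ℕ) : ℤ) := by
        rw [Int.toNat_of_nonneg h2]; exact h1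
      exact_mod_cast h3
    · intro x hx
      rw [← FML.final_iff (hSb t ht) hl (hND t (by omega)).1 (hND t (by omega)).2 (hnn t ht) (x ())]
      have hF : ∀ c : ℕ, (∃ F : Fin c → (Unit → ℕ), Function.Injective F ∧
          ∀ i, (∀ k, F i k < t ^ (2 * e + 1)) ∧
            (FML.TP Q i0 den ℓ m (2 * e + 1) t (F i) ∧ x () < F i ())) ↔
          (∃ F : Fin c → (Unit → ℕ), Function.Injective F ∧
          ∀ i, (∀ k, F i k < t ^ (2 * e + 1)) ∧
            ((F i () : ℤ) - ℓ * a i0 t ∈ frobSet (fun i => a i t) m ∧ x () < F i ())) := fun c => by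
        refine exists_congr fun F => and_congr_right fun _ => forall_congr' fun i =>
          and_congr_right fun hi => and_congr_left fun _ => hTP t ht _ hi
      change FML.LP Q i0 den ℓ m (2 * e + 1) t x ↔ _
      unfold FML.LP
      rw [hF, hF, hTP t ht x hx]
  refine FML.IsEQP.sub_poly hEQP (Polynomial.C (ℓ : ℚ) * P i0) N fun t ht => ?_
  rw [Polynomial.eval_mul, Polynomial.eval_C, ← hNa t (by omega) i0,
    Int.toNat_of_nonneg (hnn t ht)]
  push_cast
  ring
end

section
/- Let n ≥ 2 and let m be a positive integer. Let P_1, …, P_n be polynomials with rational coefficients that map ℤ into ℤ and have positive leading coefficient (so P_i(t) > 0 for all sufficiently large t). Then the function E, defined for all sufficiently large positive integers t by E(t) = G_m(P_1(t), …, P_n(t)), is eventually quasi-polynomial. -/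
open Pointwise

section semilin
variable {M : Type*} [AddCommMonoid M]

/-- Piecewise polynomial functions. -/
noncomputable def PP (M : Type*) [AddCommMonoid M] : Subalgebra ℚ (M → ℚ) :=
  Algebra.adjoin ℚ ({f | ∃ A : Set M, IsSemilinearSet A ∧ f = A.indicator 1} ∪
    {f | ∃ g : M →+ ℚ, f = g})

lemma PP_ind {A : Set M} (hA : IsSemilinearSet A) : A.indicator (1 : M → ℚ) ∈ PP M :=
  Algebra.subset_adjoin (Or.inl ⟨A, hA, rfl⟩)

lemma PP_hom (g : M →+ ℚ) : (g : M → ℚ) ∈ PP M :=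
  Algebra.subset_adjoin (Or.inr ⟨g, rfl⟩)

lemma PP_const (c : ℚ) : (fun _ => c : M → ℚ) ∈ PP M := (PP M).algebraMap_mem c

lemma PP_poly {f : M → ℚ} (hf : f ∈ PP M) (q : Polynomial ℚ) :
    (fun u => q.eval (f u)) ∈ PP M := by
  induction q using Polynomial.induction_on' with
  | add p q hp hq =>
    simp only [Polynomial.eval_add]
    exact (PP M).add_mem hp hq
  | monomial n a =>
    simp only [Polynomial.eval_monomial]
    exact (PP M).mul_mem (PP_const a) ((PP M).pow_mem hf n)

lemma PP_comp {N : Type*} [AddCommMonoid N] [AddMonoid.FG M] [IsCancelAdd N]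
    (h : M →+ N) {f : N → ℚ} (hf : f ∈ PP N) : (fun x => f (h x)) ∈ PP M := by
  induction hf using Algebra.adjoin_induction with
  | mem f hf =>
    rcases hf with ⟨A, hA, rfl⟩ | ⟨g, rfl⟩
    · have := PP_ind (hA.preimage h)
      convert this using 1
      ext x; simp [Set.indicator]; rfl
    · exact PP_hom (g.comp h)
  | algebraMap c => exact PP_const c
  | add f g _ _ hf hg => exact (PP M).add_mem hf hg
  | mul f g _ _ hf hg => exact (PP M).mul_mem hf hg

/-- graph of a function over a linear set is affine -/
lemma graph_linear {V : Type*} [AddCommGroup V] [Module ℚ V] (E : M →+ V)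
    (hE : Function.Injective E) {L : Set (M × ℕ)} (hL : IsLinearSet L)
    (hu : ∀ u y y', (u, y) ∈ L → (u, y') ∈ L → y = y') :
    ∃ (c : M →+ ℚ) (c0 : ℚ), ∀ u y, (u, y) ∈ L → (y : ℚ) = c0 + c u := by
  obtain ⟨⟨b, b'⟩, t, -, rfl⟩ := hL
  set P := AddSubmonoid.closure t with hP
  have huP : ∀ x ∈ P, ∀ y ∈ P, x.1 = y.1 → x.2 = y.2 := by
    intro x hx y hy hxy
    have h1 := hu (b + x.1) (b' + x.2) (b' + y.2) ⟨x, hx, rfl⟩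
      ⟨y, hy, by rw [hxy]; rfl⟩
    omega
  let e : M × ℕ →+ V × ℚ := AddMonoidHom.prodMap E (Nat.castAddMonoidHom ℚ)
  let W : Submodule ℚ (V × ℚ) := Submodule.span ℚ (e '' P)
  have key : ∀ w ∈ W, ∃ N : ℕ, 0 < N ∧ ∃ x ∈ P, ∃ y ∈ P, (N : ℚ) • w + e x = e y := by
    intro w hw
    induction hw using Submodule.span_induction with
    | mem w hw =>
      obtain ⟨y, hy, rfl⟩ := hw
      exact ⟨1, one_pos, 0, P.zero_mem, y, hy, by simp⟩
    | zero => exact ⟨1, one_pos, 0, P.zero_mem, 0, P.zero_mem, by simp⟩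
    | add w w' _ _ h h' =>
      obtain ⟨N, hN, x, hx, y, hy, h⟩ := h
      obtain ⟨N', hN', x', hx', y', hy', h'⟩ := h'
      refine ⟨N * N', by positivity, N' • x + N • x', P.add_mem (P.nsmul_mem hx _) (P.nsmul_mem hx' _),
        N' • y + N • y', P.add_mem (P.nsmul_mem hy _) (P.nsmul_mem hy' _), ?_⟩
      simp only [map_add, map_nsmul, ← h, ← h', ← Nat.cast_smul_eq_nsmul ℚ]
      push_cast
      module
    | smul a w _ h =>
      obtain ⟨N, hN, x, hx, y, hy, h⟩ := h
      have hd : (a.den : ℚ) ≠ 0 := by exact_mod_cast a.den_ne_zero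
      have h2 : (N : ℚ) • w = e y - e x := by rw [← h]; simp
      have ha : ((N * a.den : ℕ) : ℚ) • (a • w) = (a.num : ℚ) • (e y - e x) := by
        rw [← h2, smul_smul, smul_smul]
        congr 1
        push_cast
        have := Rat.mul_den_eq_num a
        linear_combination (N : ℚ) * this
      rcases le_total 0 a.num with h0 | h0
      · obtain ⟨k, hk⟩ := Int.eq_ofNat_of_zero_le h0
        refine ⟨N * a.den, Nat.mul_pos hN a.den_pos, k • x, P.nsmul_mem hx _, k • y, P.nsmul_mem hy _, ?_⟩
        rw [ha, hk]
        simp only [map_nsmul, ← Nat.cast_smul_eq_nsmul ℚ]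
        push_cast
        module
      · obtain ⟨k, hk⟩ := Int.eq_ofNat_of_zero_le (neg_nonneg.2 h0)
        refine ⟨N * a.den, Nat.mul_pos hN a.den_pos, k • y, P.nsmul_mem hy _, k • x, P.nsmul_mem hx _, ?_⟩
        have hk' : a.num = -k := by omega
        rw [ha, hk']
        simp only [map_nsmul, ← Nat.cast_smul_eq_nsmul ℚ]
        push_cast
        module
  let π : W →ₗ[ℚ] V := (LinearMap.fst ℚ V ℚ).comp W.subtype
  have hπ : LinearMap.ker π = ⊥ := by
    rw [LinearMap.ker_eq_bot']
    rintro ⟨w, hw⟩ h0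
    have h0 : w.1 = 0 := h0
    obtain ⟨N, hN, x, hx, y, hy, h⟩ := key w hw
    have h1 : E x.1 = E y.1 := by simpa [h0, e] using congrArg Prod.fst h
    have h2 := huP x hx y hy (hE h1)
    have h3 : (N : ℚ) * w.2 + x.2 = y.2 := by simpa [e] using congrArg Prod.snd h
    rw [h2] at h3
    have : w.2 = 0 := by
      have : (N : ℚ) * w.2 = 0 := by linarith
      rcases mul_eq_zero.1 this with h | h
      · exact absurd h (by positivity)
      · exact h
    ext <;> simp [h0, this]
  obtain ⟨ψ, hψ⟩ := LinearMap.exists_leftInverse_of_injective π hπ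
  let c : M →+ ℚ := (((LinearMap.snd ℚ V ℚ).comp W.subtype).comp ψ).toAddMonoidHom.comp E
  have hc : ∀ x ∈ P, c x.1 = x.2 := by
    intro x hx
    have hw : e x ∈ W := Submodule.subset_span ⟨x, hx, rfl⟩
    have h1 : ψ (π ⟨e x, hw⟩) = ⟨e x, hw⟩ := by
      rw [← LinearMap.comp_apply, hψ]; rfl
    have h2 : π ⟨e x, hw⟩ = E x.1 := rfl
    show (ψ (E x.1)).1.2 = _
    rw [← h2, h1]; rfl
  refine ⟨c, b' - c b, ?_⟩
  rintro u y ⟨x, hx, h⟩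
  have h1 : b + x.1 = u := congrArg Prod.fst h
  have h2 : b' + x.2 = y := congrArg Prod.snd h
  rw [← h1, ← h2, map_add, hc x hx]
  push_cast; ring

/-- fiber -/
def fib (S : Set (M × ℕ)) (u : M) : Set ℕ := {y | (u, y) ∈ S}

lemma graph_semilinear [AddMonoid.FG M] [IsCancelAdd M]
    {V : Type*} [AddCommGroup V] [Module ℚ V] (E : M →+ V)
    (hE : Function.Injective E) {T : Set (M × ℕ)} (hT : IsSemilinearSet T)
    (hu : ∀ u y y', (u, y) ∈ T → (u, y') ∈ T → y = y') :
    (∃ φ ∈ PP M, ∀ u y, (u, y) ∈ T → φ u = y) := by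
  obtain ⟨S, hS, hS', rfl⟩ := hT
  induction S, hS using Set.Finite.induction_on with
  | empty => exact ⟨0, (PP M).zero_mem, by simp⟩
  | @insert L S _ _ ih =>
    simp_rw [Set.mem_insert_iff, forall_eq_or_imp] at hS'
    obtain ⟨φ, hφ, h⟩ := ih hS'.2 (fun u y y' h1 h2 => hu u y y'
      (Set.sUnion_subset_sUnion (Set.subset_insert _ _) h1)
      (Set.sUnion_subset_sUnion (Set.subset_insert _ _) h2))
    obtain ⟨c, c0, hc⟩ := graph_linear E hE hS'.1
      (fun u y y' h1 h2 => hu u y y'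
      ⟨L, Set.mem_insert _ _, h1⟩ ⟨L, Set.mem_insert _ _, h2⟩)
    have hp : IsSemilinearSet (AddMonoidHom.fst M ℕ '' L) :=
      (hS'.1.isSemilinearSet).image _
    have hi := PP_ind hp
    refine ⟨(AddMonoidHom.fst M ℕ '' L).indicator 1 * ((fun _ => c0 : M → ℚ) + (c : M → ℚ)) +
      (1 - (AddMonoidHom.fst M ℕ '' L).indicator 1) * φ, ?_, ?_⟩
    · exact (PP M).add_mem ((PP M).mul_mem hi ((PP M).add_mem (PP_const c0) (PP_hom c)))
        ((PP M).mul_mem ((PP M).sub_mem (PP M).one_mem hi) hφ)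
    · intro u y huy
      by_cases hm : u ∈ AddMonoidHom.fst M ℕ '' L
      · obtain ⟨⟨u', y'⟩, hy', rfl⟩ := hm
        have : y = y' := hu _ _ _ huy ⟨L, Set.mem_insert _ _, hy'⟩
        subst this
        have h2 := hc _ _ hy'
        have hm : u' ∈ AddMonoidHom.fst M ℕ '' L := ⟨_, hy', rfl⟩
        simp only [AddMonoidHom.coe_fst] at hm
        simp [hm, h2]
      · have : (u, y) ∈ ⋃₀ S := by
          rw [Set.sUnion_insert] at huy
          rcases huy with h | h
          · exact absurd ⟨_, h, rfl⟩ hm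
          · exact h
        have h2 := h _ _ this
        simp only [AddMonoidHom.coe_fst] at hm
        simp [hm, h2]
end semilin

open Pointwise

section semilin2
variable {M : Type*} [AddCommMonoid M]

lemma sl_up {S : Set (M × ℕ)} (hS : IsSemilinearSet S) :
    IsSemilinearSet {p : M × ℕ | ∃ z < p.2, (p.1, z) ∈ S} := by
  have h1 : IsSemilinearSet ((((0 : M), 1) +ᵥ
      (AddSubmonoid.closure {((0 : M), 1)} : Set (M × ℕ))) : Set (M × ℕ)) :=
    IsLinearSet.isSemilinearSet ⟨_, _, Set.finite_singleton _, rfl⟩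
  convert hS.add h1 using 1
  ext ⟨u, y⟩
  simp only [Set.mem_ofPred_eq, Set.mem_add]
  constructor
  · rintro ⟨z, hz, h⟩
    refine ⟨_, h, (0, y - z), ⟨(0, y - z - 1), ?_, ?_⟩, ?_⟩
    · rw [SetLike.mem_coe, AddSubmonoid.mem_closure_singleton]
      exact ⟨y - z - 1, by simp⟩
    · simp; omega
    · simp; omega
  · rintro ⟨⟨u', z⟩, h, _, ⟨w, hw, rfl⟩, h2⟩
    rw [SetLike.mem_coe, AddSubmonoid.mem_closure_singleton] at hw
    obtain ⟨n, rfl⟩ := hw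
    simp at h2
    obtain ⟨rfl, rfl⟩ := h2
    exact ⟨z, by omega, h⟩

lemma bounded_sum [AddMonoid.FG M] [IsCancelAdd M]
    {V : Type*} [AddCommGroup V] [Module ℚ V] (E : M →+ V)
    (hE : Function.Injective E) (q : Polynomial ℚ) (K : ℕ) : ∀ (S : Set (M × ℕ)),
    IsSemilinearSet S → (∀ u, (fib S u).Finite ∧ (fib S u).ncard ≤ K) →
    (fun u => ∑ᶠ y ∈ fib S u, q.eval (y : ℚ)) ∈ PP M := by
  induction K with
  | zero =>
    intro S hS h
    have : ∀ u, fib S u = ∅ := fun u => by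
      have := h u
      rw [Set.ncard_eq_zero this.1 |>.1 (by omega)]
    simp only [this, finsum_mem_empty]
    exact PP_const 0
  | succ K ih =>
    intro S hS h
    set D := {p : M × ℕ | ∃ z < p.2, (p.1, z) ∈ S} with hD
    have hDs : IsSemilinearSet D := sl_up hS
    have huniq : ∀ u y y', (u, y) ∈ S \ D → (u, y') ∈ S \ D → y = y' := by
      rintro u y y' ⟨h1, h2⟩ ⟨h3, h4⟩
      rcases lt_trichotomy y y' with hlt | rfl | hlt
      · exact absurd ⟨y, hlt, h1⟩ h4
      · rfl
      · exact absurd ⟨y', hlt, h3⟩ h2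
    obtain ⟨φ, hφ, hφ'⟩ := graph_semilinear E hE (hS.sdiff hDs) huniq
    have hp : IsSemilinearSet (AddMonoidHom.fst M ℕ '' S) := hS.image _
    have hmin : ∀ u, (fib S u).Nonempty → ∃ y, (u, y) ∈ S \ D := by
      classical
      intro u hne
      have hne : ∃ y, (u, y) ∈ S := hne
      refine ⟨Nat.find hne, Nat.find_spec hne, ?_⟩
      rintro ⟨z, hz, hzS⟩
      exact Nat.find_min hne hz hzS
    have h1 : ∀ u, (∑ᶠ y ∈ fib (S \ D) u, q.eval (y : ℚ)) =
        (AddMonoidHom.fst M ℕ '' S).indicator (1 : M → ℚ) u * q.eval (φ u) := by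
      intro u
      by_cases hne : (fib S u).Nonempty
      · obtain ⟨y, hy⟩ := hmin u hne
        have e1 : fib (S \ D) u = {y} := by
          ext y'
          exact ⟨fun hy' => huniq u _ _ hy' hy, fun hy' => by
            rw [Set.mem_singleton_iff] at hy'; subst hy'; exact hy⟩
        have e2 : u ∈ AddMonoidHom.fst M ℕ '' S := ⟨_, hy.1, rfl⟩
        rw [e1, finsum_mem_singleton, Set.indicator_of_mem e2, hφ' u y hy]
        simp
      · have e1 : fib (S \ D) u = ∅ := by
          ext y
          simp only [Set.mem_empty_iff_false, iff_false]
          exact fun hy => hne ⟨y, hy.1⟩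
        have e2 : u ∉ AddMonoidHom.fst M ℕ '' S := by
          rintro ⟨⟨u', y⟩, hy, rfl⟩
          exact hne ⟨y, hy⟩
        rw [e1, finsum_mem_empty, Set.indicator_of_notMem e2]
        simp
    have h2 : ∀ u, (fib (S ∩ D) u).Finite ∧ (fib (S ∩ D) u).ncard ≤ K := by
      intro u
      have hsub : fib (S ∩ D) u ⊆ fib S u := fun y hy => hy.1
      refine ⟨(h u).1.subset hsub, ?_⟩
      by_cases hne : (fib S u).Nonempty
      · obtain ⟨y, hy⟩ := hmin u hne
        have : (fib (S ∩ D) u).ncard < (fib S u).ncard := by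
          apply Set.ncard_lt_ncard _ (h u).1
          exact ⟨hsub, fun hc => hy.2 (hc hy.1).2⟩
        have := (h u).2
        omega
      · rw [Set.not_nonempty_iff_eq_empty] at hne
        have : fib (S ∩ D) u = ∅ := Set.subset_empty_iff.1 (hne ▸ hsub)
        simp [this]
    have h3 := ih (S ∩ D) (hS.inter hDs) h2
    convert (PP M).add_mem h3 ((PP M).mul_mem (PP_ind hp) (PP_poly hφ q)) using 1
    ext u
    simp only [Pi.add_apply, Pi.mul_apply]
    rw [← h1 u]
    exact (finsum_mem_inter_add_sdiff (s := fib S u) (fib D u) (h u).1).symm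

/-- convexity of fibers of proper linear sets -/
lemma convex_proper [IsCancelAdd M] {L : Set (M × ℕ)} (hL : IsProperLinearSet L) :
    ∃ m : ℕ, 0 < m ∧ ∀ u y i j, i ≤ j → (u, y) ∈ L → (u, y + j * m) ∈ L → (u, y + i * m) ∈ L := by
  classical
  rw [isProperLinearSet_iff] at hL
  obtain ⟨b, t, ht, rfl⟩ := hL
  have hmem : ∀ x : M × ℕ, x ∈ (b +ᵥ (AddSubmonoid.closure (t : Set (M × ℕ)) : Set (M × ℕ))) ↔
      ∃ f : M × ℕ → ℕ, b + ∑ p ∈ t, f p • p = x := by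
    intro x
    simp only [Set.mem_vadd_set, SetLike.mem_coe, AddSubmonoid.mem_closure_finset, vadd_eq_add]
    constructor
    · rintro ⟨y, ⟨f, -, rfl⟩, rfl⟩
      exact ⟨f, rfl⟩
    · rintro ⟨f, rfl⟩
      exact ⟨_, ⟨fun p => if p ∈ t then f p else 0, fun p hp => by
        by_contra hc; simp at hp; exact hc hp.1, Finset.sum_congr rfl fun p hp => by simp [hp]⟩, rfl⟩
  simp only [hmem]
  have hind : ∀ f g : M × ℕ → ℕ, ∑ p ∈ t, f p • p = ∑ p ∈ t, g p • p → ∀ p ∈ t, f p = g p := by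
    intro f g h
    exact (linearIndepOn_finset_iffₛ.1 ht) f g (by simpa using h)
  by_cases hex : ∃ (u : M) (y s : ℕ), 0 < s ∧ (∃ f : M × ℕ → ℕ, b + ∑ p ∈ t, f p • p = (u, y)) ∧
      (∃ f : M × ℕ → ℕ, b + ∑ p ∈ t, f p • p = (u, y + s))
  · obtain ⟨u0, y0, s, hs, ⟨f, hf⟩, ⟨f', hf'⟩⟩ := hex
    refine ⟨s, hs, ?_⟩
    rintro u y i j hij ⟨g, hg⟩ ⟨g', hg'⟩
    have hff : ∑ p ∈ t, f' p • p = ∑ p ∈ t, f p • p + (0, s) := by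
      apply add_left_cancel (a := b)
      rw [hf', ← add_assoc, hf]; simp
    have hgg : ∑ p ∈ t, g' p • p = ∑ p ∈ t, g p • p + (0, j * s) := by
      apply add_left_cancel (a := b)
      rw [hg', ← add_assoc, hg]; simp
    have hsm : ∀ n : ℕ, n • ((0 : M), s) = (0, n * s) := fun n => by simp
    have h1 : ∀ p ∈ t, g' p + j * f p = g p + j * f' p := by
      apply hind (fun p => g' p + j * f p) (fun p => g p + j * f' p)
      simp only [add_smul, mul_smul, Finset.sum_add_distrib, ← Finset.smul_sum]
      rw [hff, hgg, smul_add, hsm, add_right_comm, add_assoc]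
    have h2 : ∀ p ∈ t, i * f p ≤ g p + i * f' p := by
      intro p hp
      have := h1 p hp
      rcases Nat.eq_zero_or_pos j with rfl | hj
      · obtain rfl : i = 0 := by omega
        simp
      · have h3 : j * (i * f p) ≤ j * (g p + i * f' p) := by
          calc j * (i * f p) = i * (j * f p) := by ring
            _ ≤ i * (g p + j * f' p) := Nat.mul_le_mul_left _ (by omega)
            _ = i * g p + j * (i * f' p) := by ring
            _ ≤ j * g p + j * (i * f' p) := by gcongr
            _ = _ := by ring
        exact Nat.le_of_mul_le_mul_left h3 hj
    refine ⟨fun p => g p + i * f' p - i * f p, ?_⟩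
    have h4 : ∑ p ∈ t, (g p + i * f' p - i * f p) • p + i • ∑ p ∈ t, f p • p =
        ∑ p ∈ t, g p • p + i • ∑ p ∈ t, f' p • p := by
      simp only [Finset.smul_sum, ← Finset.sum_add_distrib, ← mul_smul, ← add_smul]
      exact Finset.sum_congr rfl fun p hp => by rw [Nat.sub_add_cancel (h2 p hp)]
    rw [hff, smul_add, hsm, add_comm (i • _) ((0 : M), i * s), ← add_assoc] at h4
    have h5 := add_right_cancel h4
    rw [h5, ← add_assoc, hg]
    simp
  · refine ⟨1, one_pos, ?_⟩
    rintro u y i j hij hg hg'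
    rcases Nat.eq_zero_or_pos j with rfl | hj
    · obtain rfl : i = 0 := by omega
      simpa using hg
    · exact absurd ⟨u, y, j * 1, by omega, hg, hg'⟩ hex

lemma convex_mul {L : Set (M × ℕ)} {m c : ℕ}
    (h : ∀ u y i j, i ≤ j → (u, y) ∈ L → (u, y + j * m) ∈ L → (u, y + i * m) ∈ L) :
    ∀ u y i j, i ≤ j → (u, y) ∈ L → (u, y + j * (m * c)) ∈ L → (u, y + i * (m * c)) ∈ L := by
  intro u y i j hij h1 h2
  have := h u y (i * c) (j * c) (Nat.mul_le_mul_right _ hij) h1 (by convert h2 using 2; ring)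
  convert this using 2; ring

lemma exists_common [IsCancelAdd M] {S : Finset (Set (M × ℕ))}
    (hS : ∀ L ∈ S, IsProperLinearSet L) :
    ∃ m : ℕ, 0 < m ∧ ∀ L ∈ S, ∀ u y i j, i ≤ j → (u, y) ∈ L → (u, y + j * m) ∈ L →
      (u, y + i * m) ∈ L := by
  classical
  choose! m hm hc using fun L hL => convex_proper (hS L hL)
  refine ⟨∏ L ∈ S, m L, Finset.prod_pos hm, fun L hL => ?_⟩
  rw [← Finset.mul_prod_erase S m hL]
  exact convex_mul (hc L hL)
end semilin2

open Pointwise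

lemma antidiff (k m : ℕ) (hm : 0 < m) :
    ∃ q : Polynomial ℚ, ∀ y : ℕ, (y : ℚ) ^ k = q.eval (((y + m : ℕ)) : ℚ) - q.eval (y : ℚ) := by
  have hm' : (m : ℚ) ≠ 0 := by positivity
  refine ⟨Polynomial.C ((m : ℚ) ^ k / (k + 1)) *
    (Polynomial.bernoulli (k + 1)).comp (Polynomial.C (1 / (m : ℚ)) * Polynomial.X), fun y => ?_⟩
  simp only [Polynomial.eval_mul, Polynomial.eval_C, Polynomial.eval_comp, Polynomial.eval_X]
  have h1 : 1 / (m : ℚ) * ((y + m : ℕ) : ℚ) = 1 + 1 / (m : ℚ) * y := by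
    push_cast; field_simp; ring
  rw [h1, Polynomial.bernoulli_eval_one_add]
  have h2 : ((k : ℚ) + 1) ≠ 0 := by positivity
  simp only [Nat.add_sub_cancel]
  rw [mul_pow, one_div, inv_pow]
  push_cast
  field_simp
  ring

lemma ncard_bound {α : Type*} (𝒮 : Finset α) (m : ℕ) (hm : 0 < m) (F : Set ℕ)
    (hF : F.Finite) (P : α → ℕ → Prop) (h1 : ∀ y ∈ F, ∃ L ∈ 𝒮, P L y)
    (h2 : ∀ L ∈ 𝒮, ∀ y ∈ F, ∀ j, 0 < j → y + j * m ∈ F → P L y → P L (y + j * m) → False) :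
    F.ncard ≤ 𝒮.card * m := by
  classical
  rcases F.eq_empty_or_nonempty with rfl | ⟨y0, hy0⟩
  · simp
  obtain ⟨L0, hL0, -⟩ := h1 y0 hy0
  have : Nonempty α := ⟨L0⟩
  choose! l hl hP using h1
  rw [Set.ncard_eq_toFinset_card F hF, ← Finset.card_range m, ← Finset.card_product]
  apply Finset.card_le_card_of_injOn (fun y => (l y, y % m))
  · intro y hy
    simp only [Set.Finite.coe_toFinset] at hy
    simp [hl y hy, Nat.mod_lt _ hm]
  · have main : ∀ y ∈ F, ∀ y' ∈ F, l y = l y' → y % m = y' % m → y < y' → False := by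
      intro y hy y' hy' e1 e2 hlt
      obtain ⟨j, hj⟩ := (Nat.modEq_iff_dvd' hlt.le).1 e2
      have hj' : y' = y + j * m := by rw [mul_comm j m, ← hj]; omega
      have hj0 : 0 < j := by
        rcases Nat.eq_zero_or_pos j with rfl | h
        · simp at hj'; omega
        · exact h
      subst hj'
      exact h2 _ (hl y hy) y hy j hj0 hy' (hP y hy) (e1 ▸ hP _ hy')
    intro y hy y' hy' e
    simp only [Set.Finite.coe_toFinset] at hy hy'
    simp only [Prod.mk.injEq] at e
    rcases lt_trichotomy y y' with h | h | h
    · exact (main y hy y' hy' e.1 e.2 h).elim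
    · exact h
    · exact (main y' hy' y hy e.1.symm e.2.symm h).elim

section semilin3
variable {M : Type*} [AddCommMonoid M]

lemma sum_pow_mem [AddMonoid.FG M] [IsCancelAdd M]
    {V : Type*} [AddCommGroup V] [Module ℚ V] (E : M →+ V)
    (hE : Function.Injective E) (k : ℕ) {S : Set (M × ℕ)}
    (hS : IsSemilinearSet S) (hfin : ∀ u, (fib S u).Finite) :
    (fun u => ∑ᶠ y ∈ fib S u, (y : ℚ) ^ k) ∈ PP M := by
  classical
  obtain ⟨𝒮, h𝒮, hSe⟩ := isProperSemilinearSet_iff.1 hS.isProperSemilinearSet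
  obtain ⟨m, hm, hconv⟩ := exists_common h𝒮
  obtain ⟨q, hq⟩ := antidiff k m hm
  set B : Set (M × ℕ) := ((0 : M), m) +ᵥ S with hB
  have hBs : IsSemilinearSet B := hS.vadd _
  have hmemB : ∀ u y, (u, y) ∈ B ↔ ∃ z, y = z + m ∧ (u, z) ∈ S := by
    intro u y
    constructor
    · rintro ⟨⟨u', z⟩, hz, h⟩
      simp only [vadd_eq_add, Prod.mk_add_mk, zero_add, Prod.mk.injEq] at h
      obtain ⟨rfl, rfl⟩ := h
      exact ⟨z, add_comm _ _, hz⟩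
    · rintro ⟨z, rfl, hz⟩
      exact ⟨_, hz, by simp [add_comm]⟩
  have hfibB : ∀ u, fib B u = (· + m) '' fib S u := by
    intro u
    ext y
    simp only [fib, Set.mem_ofPred_eq, hmemB, Set.mem_image]
    exact ⟨fun ⟨z, h1, h2⟩ => ⟨z, h2, h1.symm⟩, fun ⟨z, h1, h2⟩ => ⟨z, h2.symm, h1⟩⟩
  have hfinB : ∀ u, (fib B u).Finite := fun u => by rw [hfibB]; exact (hfin u).image _
  have hStart : ∀ u, (fib (S \ B) u).Finite ∧ (fib (S \ B) u).ncard ≤ 𝒮.card * m := by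
    intro u
    have hf : (fib (S \ B) u).Finite := (hfin u).subset fun y hy => hy.1
    refine ⟨hf, ncard_bound 𝒮 m hm _ hf (fun L y => (u, y) ∈ L) ?_ ?_⟩
    · intro y hy
      have : (u, y) ∈ ⋃₀ (𝒮 : Set (Set (M × ℕ))) := hSe ▸ hy.1
      exact this
    · intro L hL y hy j hj hy' h1 h2
      have h3 := hconv L hL u y (j - 1) j (by omega) h1 h2
      apply hy'.2
      rw [hmemB]
      refine ⟨y + (j - 1) * m, ?_, ?_⟩
      · obtain ⟨i, rfl⟩ : ∃ i, j = i + 1 := ⟨j - 1, by omega⟩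
        simp; ring
      · rw [hSe]; exact ⟨L, hL, h3⟩
  have hEnd : ∀ u, (fib (B \ S) u).Finite ∧ (fib (B \ S) u).ncard ≤ 𝒮.card * m := by
    intro u
    have hf : (fib (B \ S) u).Finite := (hfinB u).subset fun y hy => hy.1
    refine ⟨hf, ncard_bound 𝒮 m hm _ hf (fun L y => ∃ z, y = z + m ∧ (u, z) ∈ L) ?_ ?_⟩
    · intro y hy
      obtain ⟨z, hz, hz'⟩ := (hmemB u y).1 hy.1
      rw [hSe] at hz'
      obtain ⟨L, hL, h⟩ := hz'
      exact ⟨L, hL, z, hz, h⟩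
    · rintro L hL y hy j hj hy' ⟨z, rfl, h1⟩ ⟨z', h', h2⟩
      have hz' : z' = z + j * m := by omega
      subst hz'
      have h3 := hconv L hL u z 1 j (by omega) h1 h2
      apply hy.2
      rw [hSe]; exact ⟨L, hL, by simpa using h3⟩
  have h1 := bounded_sum E hE q _ _ (hS.sdiff hBs) hStart
  have h2 := bounded_sum E hE q _ _ (hBs.sdiff hS) hEnd
  convert (PP M).sub_mem h2 h1 using 1
  ext u
  simp only [Pi.sub_apply, hq]
  rw [finsum_mem_sub_distrib (fun y : ℕ => q.eval (((y + m : ℕ)) : ℚ)) (fun y : ℕ => q.eval (y : ℚ)) (hfin u)]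
  have e1 : ∑ᶠ y ∈ fib S u, q.eval (((y + m : ℕ)) : ℚ) = ∑ᶠ y ∈ fib B u, q.eval (y : ℚ) := by
    rw [hfibB, finsum_mem_image (fun a _ b _ h => by simpa using h)]
  rw [e1]
  have e2 := finsum_mem_inter_add_sdiff (s := fib S u) (f := fun y : ℕ => q.eval (y : ℚ)) (fib B u) (hfin u)
  have e3 := finsum_mem_inter_add_sdiff (s := fib B u) (f := fun y : ℕ => q.eval (y : ℚ)) (fib S u) (hfinB u)
  rw [Set.inter_comm] at e3
  have e4 : fib (S \ B) u = fib S u \ fib B u := rfl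
  have e5 : fib (B \ S) u = fib B u \ fib S u := rfl
  rw [← e2, ← e3, e4, e5]
  ring

/-- generating products on `M × ℕ` -/
def PG (M : Type*) [AddCommMonoid M] : Set (M × ℕ → ℚ) :=
  {f | ∃ A : Set (M × ℕ), IsSemilinearSet A ∧ ∃ μ ∈ PP M, ∃ k : ℕ,
    f = fun p => A.indicator 1 p * μ p.1 * (p.2 : ℚ) ^ k}

lemma PP_le_span [AddMonoid.FG M] {f : M × ℕ → ℚ} (hf : f ∈ PP (M × ℕ)) :
    f ∈ Submodule.span ℚ (PG M) := by
  have hmul : ∀ f ∈ Submodule.span ℚ (PG M), ∀ g ∈ Submodule.span ℚ (PG M),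
      f * g ∈ Submodule.span ℚ (PG M) := by
    intro f hf g hg
    have := Submodule.mul_mem_mul hf hg
    rw [Submodule.span_mul_span] at this
    refine Submodule.span_mono ?_ this
    rintro _ ⟨_, ⟨A, hA, μ, hμ, k, rfl⟩, _, ⟨B, hB, ν, hν, l, rfl⟩, rfl⟩
    refine ⟨A ∩ B, hA.inter hB, μ * ν, (PP M).mul_mem hμ hν, k + l, ?_⟩
    ext p
    simp only [Pi.mul_apply, Set.inter_indicator_one]
    ring
  induction hf using Algebra.adjoin_induction with
  | mem f hf =>
    rcases hf with ⟨A, hA, rfl⟩ | ⟨g, rfl⟩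
    · exact Submodule.subset_span ⟨A, hA, 1, (PP M).one_mem, 0, by ext; simp⟩
    · have : (g : M × ℕ → ℚ) = (fun p => (Set.univ : Set (M × ℕ)).indicator 1 p *
          (g.comp (AddMonoidHom.inl M ℕ)) p.1 * (p.2 : ℚ) ^ 0) +
          (fun p => (Set.univ : Set (M × ℕ)).indicator 1 p * g (0, 1) * (p.2 : ℚ) ^ 1) := by
        ext ⟨u, y⟩
        have h1 : ((u, y) : M × ℕ) = (u, 0) + y • (0, 1) := by simp
        rw [h1, map_add, map_nsmul]
        simp [mul_comm]
      rw [this]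
      exact Submodule.add_mem _
        (Submodule.subset_span ⟨_, IsSemilinearSet.univ, _, PP_hom _, 0, rfl⟩)
        (Submodule.subset_span ⟨_, IsSemilinearSet.univ, _, PP_const (g (0, 1)), 1, rfl⟩)
  | algebraMap c =>
    exact Submodule.subset_span ⟨_, IsSemilinearSet.univ, _, PP_const c, 0, by ext; simp⟩
  | add f g _ _ hf hg => exact Submodule.add_mem _ hf hg
  | mul f g _ _ hf hg => exact hmul f hf g hg

lemma PP_sum [AddMonoid.FG M] [IsCancelAdd M]
    {V : Type*} [AddCommGroup V] [Module ℚ V] (E : M →+ V)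
    (hE : Function.Injective E) {B : Set (M × ℕ)}
    (hB : IsSemilinearSet B) (hfin : ∀ u, (fib B u).Finite) {f : M × ℕ → ℚ}
    (hf : f ∈ PP (M × ℕ)) :
    (fun u => ∑ᶠ y ∈ fib B u, f (u, y)) ∈ PP M := by
  replace hf := PP_le_span hf
  induction hf using Submodule.span_induction with
  | mem f hf =>
    obtain ⟨A, hA, μ, hμ, k, rfl⟩ := hf
    have h1 := sum_pow_mem E hE k (hB.inter hA) (fun u => (hfin u).subset fun y hy => hy.1)
    convert (PP M).mul_mem hμ h1 using 1
    ext u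
    simp only [Pi.mul_apply]
    rw [mul_finsum_mem]
    have e : fib (B ∩ A) u = fib B u ∩ fib A u := rfl
    rw [e]
    rw [finsum_mem_def, finsum_mem_def]
    congr 1
    ext y
    by_cases h1 : y ∈ fib B u <;> by_cases h2 : y ∈ fib A u
    · have h3 : (u, y) ∈ A := h2
      simp [h1, h2, h3]
    · have h3 : (u, y) ∉ A := h2
      simp [h1, h2, h3]
    · simp [h1, h2]
    · simp [h1, h2]
  | zero => simpa using PP_const 0
  | add f g _ _ hf hg =>
    convert (PP M).add_mem hf hg using 1
    ext u
    simp only [Pi.add_apply]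
    exact finsum_mem_add_distrib (hfin u)
  | smul c f _ hf =>
    convert (PP M).smul_mem hf c using 1
    ext u
    simp only [Pi.smul_apply, smul_eq_mul]
    rw [mul_finsum_mem]
end semilin3


/-- rational version of EQP -/
def EQ (f : ℕ → ℚ) : Prop :=
  ∃ d : ℕ, 0 < d ∧ ∃ R : ℕ → Polynomial ℚ, ∃ N : ℕ,
    ∀ t : ℕ, N ≤ t → f t = (R (t % d)).eval (t : ℚ)

lemma EQ_op (op : ℚ → ℚ → ℚ) (Op : Polynomial ℚ → Polynomial ℚ → Polynomial ℚ)
    (h : ∀ p q x, (Op p q).eval x = op (p.eval x) (q.eval x)) {f g : ℕ → ℚ} (hf : EQ f) (hg : EQ g) :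
    EQ (fun t => op (f t) (g t)) := by
  obtain ⟨d, hd, R, N, hR⟩ := hf
  obtain ⟨d', hd', R', N', hR'⟩ := hg
  refine ⟨d * d', Nat.mul_pos hd hd', fun i => Op (R (i % d)) (R' (i % d')), max N N', ?_⟩
  intro t ht
  beta_reduce
  rw [h, Nat.mod_mul_right_mod, Nat.mod_mul_left_mod, hR t (le_of_max_le_left ht),
    hR' t (le_of_max_le_right ht)]

lemma EQ_ind {A : Set ℕ} (hA : IsSemilinearSet A) : EQ (A.indicator 1) := by
  classical
  obtain ⟨k, p, hp, h⟩ := Nat.isSemilinearSet_iff_ultimately_periodic.1 hA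
  have h1 : ∀ t ≥ k, ∀ j, t ∈ A ↔ t + j * p ∈ A := by
    intro t ht j
    induction j with
    | zero => simp
    | succ j ih =>
      rw [ih, h (t + j * p) (by omega)]
      ring_nf
  have h2 : ∀ t ≥ k, ∀ t' ≥ k, t % p = t' % p → t ≤ t' → (t ∈ A ↔ t' ∈ A) := by
    intro t ht t' ht' e hle
    obtain ⟨j, hj⟩ := (Nat.modEq_iff_dvd' hle).1 e
    have hj' : t' = t + j * p := by rw [mul_comm j p, ← hj]; omega
    rw [hj']; exact h1 t ht j
  have h3 : ∀ t ≥ k, ∀ t' ≥ k, t % p = t' % p → (t ∈ A ↔ t' ∈ A) := by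
    intro t ht t' ht' e
    rcases le_total t t' with hle | hle
    · exact h2 t ht t' ht' e hle
    · exact (h2 t' ht' t ht e.symm hle).symm
  refine ⟨p, hp, fun i => if ∃ t ≥ k, t % p = i ∧ t ∈ A then 1 else 0, k, fun t ht => ?_⟩
  beta_reduce
  by_cases hm : t ∈ A
  · rw [if_pos ⟨t, ht, rfl, hm⟩]; simp [hm]
  · rw [if_neg]
    · simp [hm]
    · rintro ⟨t', ht', e, hm'⟩
      exact hm ((h3 t' ht' t ht e).1 hm')

lemma PP_EQ {f : ℕ → ℚ} (hf : f ∈ PP ℕ) : EQ f := by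
  induction hf using Algebra.adjoin_induction with
  | mem f hf =>
    rcases hf with ⟨A, hA, rfl⟩ | ⟨g, rfl⟩
    · exact EQ_ind hA
    · refine ⟨1, one_pos, fun _ => Polynomial.C (g 1) * Polynomial.X, 0, fun t _ => ?_⟩
      have : g t = t * g 1 := by
        rw [← nsmul_eq_mul, ← map_nsmul]; simp
      simp only [Polynomial.eval_mul, Polynomial.eval_C, Polynomial.eval_X]
      rw [this, mul_comm]
  | algebraMap c => exact ⟨1, one_pos, fun _ => Polynomial.C c, 0, fun t _ => by simp⟩
  | add f g _ _ hf hg => exact EQ_op (· + ·) (· + ·) (by simp) hf hg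
  | mul f g _ _ hf hg => exact EQ_op (· * ·) (· * ·) (by simp) hf hg

/-- cons hom -/
def consHom (r : ℕ) : (ℕ × (Fin r → ℕ)) × ℕ →+ ℕ × (Fin (r + 1) → ℕ) where
  toFun p := (p.1.1, Fin.cons p.2 p.1.2)
  map_zero' := by
    ext i
    · rfl
    · refine Fin.cases ?_ (fun j => ?_) i <;> simp
  map_add' p q := by
    ext i
    · rfl
    · refine Fin.cases ?_ (fun j => ?_) i <;> simp

lemma sl_lt {M : Type*} [AddCommMonoid M] [AddMonoid.FG M] (f g : M →+ ℕ) :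
    IsSemilinearSet {x | f x < g x} := by
  have h0 : IsSemilinearSet {p : M × ℕ | 1 + (f.comp (AddMonoidHom.fst M ℕ) +
      AddMonoidHom.snd M ℕ) p = 0 + (g.comp (AddMonoidHom.fst M ℕ)) p} :=
    isSemilinearSet_setOfPred_eq _ _ _ _
  convert h0.image (AddMonoidHom.fst M ℕ) using 1
  ext x
  simp only [Set.mem_ofPred_eq, Set.mem_image]
  constructor
  · intro h
    refine ⟨(x, g x - f x - 1), ?_, rfl⟩
    simp; omega
  · rintro ⟨⟨x', z⟩, h, rfl⟩
    simp at h ⊢; omega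

lemma PP_box (r : ℕ) : ∀ f ∈ PP (ℕ × (Fin r → ℕ)),
    (fun t : ℕ => ∑ x ∈ Fintype.piFinset (fun _ : Fin r => Finset.range t), f (t, x)) ∈ PP ℕ := by
  induction r with
  | zero =>
    intro f hf
    have := PP_comp (AddMonoidHom.inl ℕ (Fin 0 → ℕ)) hf
    convert this using 1
    ext t
    simp
    congr 1
  | succ r ih =>
    intro f hf
    let E : ℕ × (Fin r → ℕ) →+ ℚ × (Fin r → ℚ) :=
      AddMonoidHom.prodMap (Nat.castAddMonoidHom ℚ) ((Nat.castAddMonoidHom ℚ).compLeft (Fin r))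
    have hE : Function.Injective E := by
      rintro ⟨t, x⟩ ⟨t', x'⟩ h
      have h1 : (t : ℚ) = t' := congrArg Prod.fst h
      have h2 : ∀ i, (x i : ℚ) = x' i := fun i => congrFun (congrArg Prod.snd h) i
      ext i
      · exact_mod_cast h1
      · exact_mod_cast h2 i
    have hB : IsSemilinearSet {p : (ℕ × (Fin r → ℕ)) × ℕ | p.2 < p.1.1} :=
      sl_lt (AddMonoidHom.snd (ℕ × (Fin r → ℕ)) ℕ)
        ((AddMonoidHom.fst ℕ (Fin r → ℕ)).comp (AddMonoidHom.fst (ℕ × (Fin r → ℕ)) ℕ))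
    have hfib : ∀ u : ℕ × (Fin r → ℕ), fib {p : (ℕ × (Fin r → ℕ)) × ℕ | p.2 < p.1.1} u =
        (Finset.range u.1 : Set ℕ) := by
      intro u; ext y; simp [fib]
    have h1 := PP_sum E hE hB (fun u => by rw [hfib]; exact Finset.finite_toSet _)
      (PP_comp (consHom r) hf)
    have h2 := ih _ h1
    convert h2 using 1
    ext t
    simp only [hfib, finsum_mem_coe_finset]
    rw [← Finset.sum_product']
    refine Finset.sum_nbij' (fun x => (Fin.tail x, x 0)) (fun p => Fin.cons p.2 p.1) ?_ ?_ ?_ ?_ ?_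
    · intro x hx
      simp only [Fintype.mem_piFinset, Finset.mem_range, Finset.mem_product, Fin.tail] at hx ⊢
      exact ⟨fun i => hx _, hx 0⟩
    · intro p hp
      simp only [Fintype.mem_piFinset, Finset.mem_range, Finset.mem_product] at hp ⊢
      exact fun i => Fin.cases (by simpa using hp.2) (fun j => by simpa using hp.1 j) i
    · intro x _; simp
    · intro p _; simp
    · intro x _; simp [consHom]

lemma EQ_count {r : ℕ} {S : Set (ℕ × (Fin r → ℕ))} (hS : IsSemilinearSet S)
    (hb : ∀ t x, (t, x) ∈ S → ∀ i, x i < t) :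
    EQ (fun t => ({x | (t, x) ∈ S}.ncard : ℚ)) := by
  classical
  have h := PP_EQ (PP_box r _ (PP_ind hS))
  convert h using 2 with t
  have : {x | (t, x) ∈ S} = ((Fintype.piFinset (fun _ : Fin r => Finset.range t)).filter
      (fun x => (t, x) ∈ S) : Finset (Fin r → ℕ)) := by
    ext x
    simp only [Set.mem_ofPred_eq, Finset.coe_filter, Fintype.mem_piFinset, Finset.mem_range]
    exact ⟨fun h => ⟨hb t x h, h⟩, fun h => h.2⟩
  rw [this, Set.ncard_coe_finset, Finset.card_filter]
  push_cast
  rfl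


section defin
variable {M : Type*} [AddCommMonoid M] [AddMonoid.FG M]

lemma sl_carry (τ : M →+ ℤ) {D : Set M} (hD : IsSemilinearSet D) (hpos : ∀ x ∈ D, 1 ≤ τ x) (q : ℕ) :
    ∀ (L : ℕ → (M →+ ℤ)), (∀ j, ∃ C : ℤ, ∀ x ∈ D, |L j x| ≤ C * τ x) → ∀ c : ℤ,
    IsSemilinearSet {x | x ∈ D ∧ c + ∑ j ∈ Finset.range q, L j x * τ x ^ j = 0} := by
  induction q with
  | zero =>
    intro L _ c
    by_cases hc : c = 0
    · simpa [hc] using hD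
    · simp [hc]
  | succ q ih =>
    intro L hL c
    obtain ⟨C, hC⟩ := hL 0
    have key : {x | x ∈ D ∧ c + ∑ j ∈ Finset.range (q + 1), L j x * τ x ^ j = 0} =
        ⋃ c' ∈ Finset.Icc (-(|c| + C)) (|c| + C), ({x | c + L 0 x = 0 + (c' • τ) x} ∩
          {x | x ∈ D ∧ c' + ∑ j ∈ Finset.range q, L (j + 1) x * τ x ^ j = 0}) := by
      ext x
      simp only [Set.mem_ofPred_eq, Set.mem_iUnion, Set.mem_inter_iff, Finset.mem_Icc, exists_prop]
      have hsum : ∑ j ∈ Finset.range (q + 1), L j x * τ x ^ j =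
          τ x * ∑ j ∈ Finset.range q, L (j + 1) x * τ x ^ j + L 0 x := by
        rw [Finset.sum_range_succ', Finset.mul_sum]
        simp only [pow_zero, mul_one]
        congr 1
        exact Finset.sum_congr rfl fun j _ => by ring
      rw [hsum]
      set R := ∑ j ∈ Finset.range q, L (j + 1) x * τ x ^ j
      simp only [AddMonoidHom.smul_apply, smul_eq_mul, zero_add]
      constructor
      · rintro ⟨hx, h⟩
        have hτ := hpos x hx
        have h1 : c + L 0 x = (-R) * τ x := by linarith
        refine ⟨-R, ?_, h1, hx, by ring⟩
        rw [← abs_le]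
        have h2 : |-R| * τ x ≤ (|c| + C) * τ x := by
          calc |-R| * τ x = |(-R) * τ x| := by rw [abs_mul, abs_of_nonneg (by omega : 0 ≤ τ x)]
            _ = |c + L 0 x| := by rw [h1]
            _ ≤ |c| + |L 0 x| := abs_add_le _ _
            _ ≤ |c| * τ x + C * τ x := by
                have := hC x hx
                nlinarith [abs_nonneg c]
            _ = _ := by ring
        exact le_of_mul_le_mul_right h2 (by omega)
      · rintro ⟨c', -, h1, hx, h2⟩
        refine ⟨hx, ?_⟩
        have : c' = -R := by linarith
        subst this
        linarith
    rw [key]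
    exact IsSemilinearSet.biUnion_finset fun c' _ =>
      (isSemilinearSet_setOfPred_eq _ _ _ _).inter (ih (fun j => L (j + 1)) (fun j => hL (j + 1)) c')

lemma deg_bound (Φ : M →+ Polynomial ℤ) : ∃ q, ∀ x, (Φ x).natDegree < q := by
  obtain ⟨s, hs⟩ := (AddMonoid.FG.fg_top : (⊤ : AddSubmonoid M).FG)
  refine ⟨s.sup (fun x => (Φ x).natDegree) + 1, fun x => Nat.lt_succ_of_le ?_⟩
  have hx : x ∈ AddSubmonoid.closure (s : Set M) := by rw [hs]; trivial
  induction hx using AddSubmonoid.closure_induction with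
  | mem x hx => exact Finset.le_sup (f := fun x => (Φ x).natDegree) hx
  | zero => simp
  | add x y _ _ hx hy =>
    rw [map_add]
    exact (Polynomial.natDegree_add_le _ _).trans (max_le hx hy)

lemma sl_eval (τ : M →+ ℕ) {D : Set M} (hD : IsSemilinearSet D) (hpos : ∀ x ∈ D, 0 < τ x)
    (hb : ∀ L : M →+ ℤ, ∃ C : ℤ, ∀ x ∈ D, |L x| ≤ C * τ x) (Φ : M →+ Polynomial ℤ) :
    IsSemilinearSet {x | x ∈ D ∧ (Φ x).eval (τ x : ℤ) = 0} := by
  obtain ⟨q, hq⟩ := deg_bound Φ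
  have := sl_carry ((Nat.castAddMonoidHom ℤ).comp τ) hD
    (fun x hx => by have := hpos x hx; simp; omega) q
    (fun j => (Polynomial.lcoeff ℤ j).toAddMonoidHom.comp Φ) (fun j => by simpa using hb ((Polynomial.lcoeff ℤ j).toAddMonoidHom.comp Φ)) 0
  convert this using 1
  ext x
  simp only [Set.mem_ofPred_eq, zero_add]
  rw [Polynomial.eval_eq_sum_range' (hq x)]
  rfl
end defin

lemma pi_bound {κ : Type*} [Fintype κ] (h : (κ → ℕ) →+ ℤ) :
    ∃ C : ℤ, ∀ (t : ℕ) (y : κ → ℕ), (∀ i, y i < t) → |h y| ≤ C * t := by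
  classical
  refine ⟨∑ i, |h (Pi.single i 1)|, fun t y hy => ?_⟩
  have e : y = ∑ i, y i • (Pi.single i 1 : κ → ℕ) := by
    ext j
    simp [Finset.sum_apply, Pi.single_apply]
  have : h y = ∑ i, (y i : ℤ) * h (Pi.single i 1) := by
    conv_lhs => rw [e]
    rw [map_sum]
    exact Finset.sum_congr rfl fun i _ => by rw [map_nsmul, nsmul_eq_mul]
  rw [this, Finset.sum_mul]
  refine (Finset.abs_sum_le_sum_abs _ _).trans (Finset.sum_le_sum fun i _ => ?_)
  rw [abs_mul, mul_comm]
  have h1 : |(y i : ℤ)| ≤ t := by rw [abs_of_nonneg (by positivity)]; exact_mod_cast (hy i).le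
  exact mul_le_mul_of_nonneg_left h1 (abs_nonneg _)

/-- box -/
def DD (ι κ : Type*) : Set (ℕ × (ι → ℕ) × (κ → ℕ)) :=
  {z | 0 < z.1 ∧ (∀ i, z.2.1 i < z.1) ∧ ∀ i, z.2.2 i < z.1}

section box
variable {ι κ : Type*} [Fintype ι] [Fintype κ]

lemma sl_DD : IsSemilinearSet (DD ι κ) := by
  have h0 : IsSemilinearSet {z : ℕ × (ι → ℕ) × (κ → ℕ) | 0 < z.1} :=
    sl_lt 0 (AddMonoidHom.fst ℕ ((ι → ℕ) × (κ → ℕ)))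
  have h1 : IsSemilinearSet (⋂ i, {z : ℕ × (ι → ℕ) × (κ → ℕ) | z.2.1 i < z.1}) :=
    IsSemilinearSet.iInter fun i =>
      sl_lt ((Pi.evalAddMonoidHom (fun _ : ι => ℕ) i).comp ((AddMonoidHom.fst (ι → ℕ) (κ → ℕ)).comp
        (AddMonoidHom.snd ℕ ((ι → ℕ) × (κ → ℕ))))) (AddMonoidHom.fst ℕ ((ι → ℕ) × (κ → ℕ)))
  have h2 : IsSemilinearSet (⋂ i, {z : ℕ × (ι → ℕ) × (κ → ℕ) | z.2.2 i < z.1}) :=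
    IsSemilinearSet.iInter fun i =>
      sl_lt ((Pi.evalAddMonoidHom (fun _ : κ => ℕ) i).comp ((AddMonoidHom.snd (ι → ℕ) (κ → ℕ)).comp
        (AddMonoidHom.snd ℕ ((ι → ℕ) × (κ → ℕ))))) (AddMonoidHom.fst ℕ ((ι → ℕ) × (κ → ℕ)))
  convert h0.inter (h1.inter h2) using 1
  ext z
  simp [DD]

lemma sl_evalDD (Φ : ℕ × (ι → ℕ) × (κ → ℕ) →+ Polynomial ℤ) :
    IsSemilinearSet {z | z ∈ DD ι κ ∧ (Φ z).eval (z.1 : ℤ) = 0} := by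
  refine sl_eval (AddMonoidHom.fst ℕ ((ι → ℕ) × (κ → ℕ))) sl_DD (fun x hx => hx.1) ?_ Φ
  intro L
  obtain ⟨C1, h1⟩ := pi_bound (L.comp ((AddMonoidHom.inr ℕ ((ι → ℕ) × (κ → ℕ))).comp
    (AddMonoidHom.inl (ι → ℕ) (κ → ℕ))))
  obtain ⟨C2, h2⟩ := pi_bound (L.comp ((AddMonoidHom.inr ℕ ((ι → ℕ) × (κ → ℕ))).comp
    (AddMonoidHom.inr (ι → ℕ) (κ → ℕ))))
  refine ⟨|L (1, 0, 0)| + C1 + C2, ?_⟩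
  rintro ⟨t, x, y⟩ ⟨ht, hx, hy⟩
  have e : ((t, x, y) : ℕ × (ι → ℕ) × (κ → ℕ)) = t • (1, 0, 0) + (0, x, 0) + (0, 0, y) := by simp
  have h1 : |L (0, x, 0)| ≤ C1 * t := h1 t x hx
  have h2 : |L (0, 0, y)| ≤ C2 * t := h2 t y hy
  have h0 : |L (t • (1, 0, 0))| = |L (1, 0, 0)| * t := by
    rw [map_nsmul, nsmul_eq_mul, abs_mul, mul_comm]; simp
  rw [e, map_add, map_add]
  refine (abs_add_three _ _ _).trans ?_
  rw [h0]
  simp only [← e, AddMonoidHom.coe_fst]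
  nlinarith
end box

/-- value of digits -/
def val {r : ℕ} (t : ℕ) (x : Fin r → ℕ) : ℕ := ∑ j, x j * t ^ (j : ℕ)

/-- digit polynomial -/
noncomputable def dpoly {r : ℕ} : (Fin r → ℕ) →+ Polynomial ℤ where
  toFun x := ∑ j, (x j : Polynomial ℤ) * Polynomial.X ^ (j : ℕ)
  map_zero' := by simp
  map_add' x y := by simp [add_mul, Finset.sum_add_distrib]

lemma dpoly_eval {r : ℕ} (t : ℕ) (x : Fin r → ℕ) : (dpoly x).eval (t : ℤ) = val t x := by
  simp [dpoly, val, Polynomial.eval_finsetSum]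

/-- the equation relation -/
def DRel {κ : Type*} [Fintype κ] (r : ℕ) (p : κ → Polynomial ℤ) :
    Set (ℕ × (Fin r → ℕ) × (κ × Fin r → ℕ)) :=
  {z | z ∈ DD (Fin r) (κ × Fin r) ∧
    ∑ i, (p i).eval (z.1 : ℤ) * (val z.1 (fun j => z.2.2 (i, j)) : ℤ) = val z.1 z.2.1}

lemma sl_DRel {κ : Type*} [Fintype κ] (r : ℕ) (p : κ → Polynomial ℤ) :
    IsSemilinearSet (DRel r p) := by
  let Ψ : (κ × Fin r → ℕ) →+ Polynomial ℤ :=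
    { toFun := fun y => ∑ i, p i * dpoly (fun j => y (i, j))
      map_zero' := by
        have : ∀ i : κ, (fun j : Fin r => (0 : κ × Fin r → ℕ) (i, j)) = 0 := fun i => rfl
        simp only [this, map_zero, mul_zero, Finset.sum_const_zero]
      map_add' := fun y y' => by
        have : ∀ i : κ, (fun j : Fin r => (y + y') (i, j)) =
          (fun j => y (i, j)) + (fun j => y' (i, j)) := fun i => rfl
        simp only [this, map_add, mul_add, Finset.sum_add_distrib] }
  let Φ : ℕ × (Fin r → ℕ) × (κ × Fin r → ℕ) →+ Polynomial ℤ :=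
    Ψ.comp ((AddMonoidHom.snd (Fin r → ℕ) (κ × Fin r → ℕ)).comp
      (AddMonoidHom.snd ℕ ((Fin r → ℕ) × (κ × Fin r → ℕ)))) -
    dpoly.comp ((AddMonoidHom.fst (Fin r → ℕ) (κ × Fin r → ℕ)).comp
      (AddMonoidHom.snd ℕ ((Fin r → ℕ) × (κ × Fin r → ℕ))))
  convert sl_evalDD Φ using 1
  ext ⟨t, x, y⟩
  simp only [DRel, Set.mem_ofPred_eq]
  refine and_congr_right fun _ => ?_
  have : Φ (t, x, y) = ∑ i, p i * dpoly (fun j => y (i, j)) - dpoly x := rfl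
  rw [this, Polynomial.eval_sub, Polynomial.eval_finsetSum, dpoly_eval, sub_eq_zero]
  simp only [Polynomial.eval_mul, dpoly_eval]

/-- projection -/
def prj (ι κ : Type*) : ℕ × (ι → ℕ) × (κ → ℕ) →+ ℕ × (ι → ℕ) where
  toFun z := (z.1, z.2.1)
  map_zero' := rfl
  map_add' _ _ := rfl

/-- block selection -/
def blk (ι κ l : Type*) (i : l) : ℕ × (ι → ℕ) × (l × κ → ℕ) →+ ℕ × (ι → ℕ) × (κ → ℕ) where
  toFun z := (z.1, z.2.1, fun k => z.2.2 (i, k))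
  map_zero' := rfl
  map_add' _ _ := rfl

/-- representable `m` times -/
def RepM {κ : Type*} [Fintype κ] (m r : ℕ) (p : κ → Polynomial ℤ) : Set (ℕ × (Fin r → ℕ)) :=
  {z | ∃ y : Fin m × (κ × Fin r) → ℕ, (∀ l, (z.1, z.2, fun k => y (l, k)) ∈ DRel r p) ∧
    ∀ l l', l ≠ l' → (fun k => y (l, k)) ≠ fun k => y (l', k)}

lemma sl_RepM {κ : Type*} [Fintype κ] (m r : ℕ) (p : κ → Polynomial ℤ) :
    IsSemilinearSet (RepM m r p) := by
  have h1 : IsSemilinearSet (⋂ l, blk (Fin r) (κ × Fin r) (Fin m) l ⁻¹' DRel r p) :=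
    IsSemilinearSet.iInter fun l => (sl_DRel r p).preimage _
  have h2 : IsSemilinearSet (⋂ ll : {ll : Fin m × Fin m // ll.1 ≠ ll.2},
      {z | 0 + blk (Fin r) (κ × Fin r) (Fin m) ll.1.1 z =
        0 + blk (Fin r) (κ × Fin r) (Fin m) ll.1.2 z}ᶜ) :=
    IsSemilinearSet.iInter fun ll =>
      (isSemilinearSet_setOfPred_eq _ _ _ _).compl
  convert (h1.inter h2).image (prj _ _) using 1
  ext ⟨t, x⟩
  simp only [RepM, Set.mem_ofPred_eq, Set.mem_image, Set.mem_inter_iff, Set.mem_iInter,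
    Set.mem_preimage, Set.mem_compl_iff, zero_add]
  constructor
  · rintro ⟨y, h1, h2⟩
    refine ⟨(t, x, y), ⟨h1, fun ll hc => h2 _ _ ll.2 ?_⟩, rfl⟩
    exact congrArg (fun z => z.2.2) hc
  · rintro ⟨⟨t', x', y⟩, ⟨h1, h2⟩, h⟩
    obtain ⟨rfl, rfl⟩ : t' = t ∧ x' = x := by simpa [prj] using h
    refine ⟨y, h1, fun l l' hl hc => h2 ⟨(l, l'), hl⟩ ?_⟩
    show (t', x', fun k => y (l, k)) = (t', x', fun k => y (l', k))
    rw [hc]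

/-- the final semilinear set -/
def FS {κ κ' : Type*} [Fintype κ] [Fintype κ'] (m r : ℕ) (p : κ → Polynomial ℤ)
    (p' : κ' → Polynomial ℤ) : Set (ℕ × (Fin r → ℕ)) :=
  {z | z.2 ≠ 0 ∧ (∃ y, (z.1, z.2, y) ∈ DRel r p') ∧ z ∉ RepM m r p}

lemma sl_FS {κ κ' : Type*} [Fintype κ] [Fintype κ'] (m r : ℕ) (p : κ → Polynomial ℤ)
    (p' : κ' → Polynomial ℤ) : IsSemilinearSet (FS m r p p') := by
  have h0 : IsSemilinearSet {z : ℕ × (Fin r → ℕ) | 0 + AddMonoidHom.snd ℕ (Fin r → ℕ) z =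
      0 + (0 : ℕ × (Fin r → ℕ) →+ (Fin r → ℕ)) z} := isSemilinearSet_setOfPred_eq _ _ _ _
  have h1 := (sl_DRel r p').image (prj _ _)
  convert h0.compl.inter (h1.inter (sl_RepM m r p).compl) using 1
  ext ⟨t, x⟩
  simp only [FS, Set.mem_ofPred_eq, Set.mem_inter_iff, Set.mem_compl_iff, Set.mem_image, zero_add]
  refine and_congr Iff.rfl (and_congr ?_ Iff.rfl)
  constructor
  · rintro ⟨y, hy⟩
    exact ⟨_, hy, rfl⟩
  · rintro ⟨⟨t', x', y⟩, hy, h⟩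
    obtain ⟨rfl, rfl⟩ : t' = t ∧ x' = x := by simpa [prj] using h
    exact ⟨y, hy⟩

lemma EQ_FS {κ κ' : Type*} [Fintype κ] [Fintype κ'] (m r : ℕ) (p : κ → Polynomial ℤ)
    (p' : κ' → Polynomial ℤ) : EQ (fun t => ({x | (t, x) ∈ FS m r p p'}.ncard : ℚ)) :=
  EQ_count (sl_FS m r p p') fun _ _ h => by
    obtain ⟨-, ⟨y, hy⟩, -⟩ := h
    exact hy.1.2.1




lemma val_eq {r s : ℕ} (x : Fin r → ℕ) (h : ∀ j, x j < s) :
    (finFunctionFinEquiv (fun j => (⟨x j, h j⟩ : Fin s)) : ℕ) = val s x := by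
  rw [finFunctionFinEquiv_apply]; rfl

lemma val_lt {r s : ℕ} (x : Fin r → ℕ) (h : ∀ j, x j < s) : val s x < s ^ r := by
  rw [← val_eq x h]; exact Fin.is_lt _

lemma val_inj {r s : ℕ} {x y : Fin r → ℕ} (hx : ∀ j, x j < s) (hy : ∀ j, y j < s)
    (h : val s x = val s y) : x = y := by
  rw [← val_eq x hx, ← val_eq y hy] at h
  have := finFunctionFinEquiv.injective (Fin.ext h)
  funext j
  exact congrArg Fin.val (congrFun this j)

lemma val_surj {r s : ℕ} (v : ℕ) (hv : v < s ^ r) : ∃ x : Fin r → ℕ, (∀ j, x j < s) ∧ val s x = v := by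
  let f : Fin r → Fin s := finFunctionFinEquiv.symm ⟨v, hv⟩
  refine ⟨fun j => f j, fun j => (f j).2, ?_⟩
  rw [← val_eq _ (fun j => (f j).2)]
  exact congrArg Fin.val (finFunctionFinEquiv.apply_symm_apply ⟨v, hv⟩)

lemma DRel_mk {κ : Type*} [Fintype κ] {r s : ℕ} {p : κ → Polynomial ℤ} (hs : 0 < s) {x : Fin r → ℕ}
    (hx : ∀ j, x j < s) (y : κ × Fin r → ℕ) (hy : ∀ k, y k < s) (v : κ → ℕ)
    (hyv : ∀ i, val s (fun j => y (i, j)) = v i)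
    (h : ∑ i, (p i).eval (s : ℤ) * (v i : ℤ) = val s x) : (s, x, y) ∈ DRel r p := by
  refine ⟨⟨hs, hx, hy⟩, ?_⟩
  simpa only [hyv] using h

lemma bezout {n : ℕ} (a : Fin n → ℤ) (ha : ∀ i, 0 < a i) (i0 : Fin n) (k : ℤ)
    (hk : Finset.univ.gcd a ∣ k) :
    ∃ c : Fin n → ℤ, k = ∑ i, c i * a i ∧ ∀ i, i ≠ i0 → 0 ≤ c i ∧ c i < a i0 := by
  classical
  have h1 : ∃ c : Fin n → ℤ, k = ∑ i, c i * a i := by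
    have h2 : k ∈ Ideal.span (Set.range a) := by
      have h3 : Submodule.IsPrincipal.generator (Ideal.span (Set.range a)) ∣ Finset.univ.gcd a := by
        refine Finset.dvd_gcd fun i _ => ?_
        rw [← Submodule.IsPrincipal.mem_iff_generator_dvd]
        exact Ideal.subset_span ⟨i, rfl⟩
      rw [Submodule.IsPrincipal.mem_iff_generator_dvd]
      exact h3.trans hk
    obtain ⟨c, hc⟩ := (Ideal.mem_span_range_iff_exists_fun).1 h2
    exact ⟨c, hc.symm⟩
  obtain ⟨c, hc⟩ := h1
  have hd : a i0 ∣ k - ∑ i ∈ Finset.univ.erase i0, (c i % a i0) * a i := by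
    rw [hc, ← Finset.add_sum_erase _ _ (Finset.mem_univ i0), add_sub_assoc, ← Finset.sum_sub_distrib]
    refine dvd_add (Dvd.intro_left _ rfl) (Finset.dvd_sum fun i _ => ?_)
    rw [← sub_mul]
    exact Dvd.dvd.mul_right (Int.dvd_self_sub_emod) _
  obtain ⟨q, hq⟩ := hd
  refine ⟨fun i => if i = i0 then q else c i % a i0, ?_, ?_⟩
  · rw [← Finset.add_sum_erase _ _ (Finset.mem_univ i0)]
    have : ∑ i ∈ Finset.univ.erase i0, (if i = i0 then q else c i % a i0) * a i =
        ∑ i ∈ Finset.univ.erase i0, (c i % a i0) * a i :=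
      Finset.sum_congr rfl fun i hi => by rw [if_neg (Finset.ne_of_mem_erase hi)]
    rw [this]
    simp only [if_true]
    linarith
  · intro i hi
    simp only [if_neg hi]
    exact ⟨Int.emod_nonneg _ (ha i0).ne', Int.emod_lt_of_pos _ (ha i0)⟩

lemma sol_le {n : ℕ} {a : Fin n → ℤ} (ha : ∀ i, 0 < a i) {k : ℤ} {b : Fin n → ℕ}
    (hb : k = ∑ i, (b i : ℤ) * a i) (i : Fin n) : (b i : ℤ) ≤ k := by
  rw [hb]
  calc (b i : ℤ) ≤ (b i : ℤ) * a i := le_mul_of_one_le_right (by positivity) (ha i)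
    _ ≤ _ := Finset.single_le_sum (f := fun i => (b i : ℤ) * a i)
      (fun j _ => mul_nonneg (by positivity) (ha j).le) (Finset.mem_univ i)

lemma sol_finite {n : ℕ} {a : Fin n → ℤ} (ha : ∀ i, 0 < a i) (k : ℤ) :
    {b : Fin n → ℕ | k = ∑ i, (b i : ℤ) * a i}.Finite := by
  refine (Set.finite_Iic (fun _ : Fin n => k.toNat)).subset fun b hb i => ?_
  have := sol_le ha hb i
  show b i ≤ k.toNat
  omega

lemma le_ncard_iff {α : Type*} {S : Set α} (hS : S.Finite) (m : ℕ) :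
    m ≤ S.ncard ↔ ∃ f : Fin m → α, Function.Injective f ∧ ∀ l, f l ∈ S := by
  constructor
  · intro h
    obtain ⟨T, hT, hc⟩ := Set.exists_subset_card_eq h
    have hTf := hS.subset hT
    have : Nonempty (Fin m ≃ T) := by
      have := hTf.to_subtype
      exact ⟨((Finite.equivFinOfCardEq (by rw [← hc]; rfl) : T ≃ Fin m)).symm⟩
    obtain ⟨e⟩ := this
    exact ⟨fun l => e l, Subtype.val_injective.comp e.injective, fun l => hT (e l).2⟩
  · rintro ⟨f, hf, hm⟩
    have h1 : (Set.range f).ncard = m := by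
      rw [Set.ncard_range_of_injective hf]; simp
    rw [← h1]
    exact Set.ncard_le_ncard (by rintro _ ⟨l, rfl⟩; exact hm l) hS

lemma coef_bound {n : ℕ} {a : Fin n → ℤ} (ha : ∀ i, 0 < a i) {i0 : Fin n} {c : Fin n → ℤ}
    (hc : ∀ i, i ≠ i0 → 0 ≤ c i ∧ c i < a i0) {k : ℤ} (hk : k = ∑ i, c i * a i) :
    k ≤ (c i0 + ∑ i, a i) * a i0 ∧ c i0 * a i0 ≤ k := by
  classical
  rw [← Finset.add_sum_erase _ _ (Finset.mem_univ i0)] at hk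
  have h1 : ∑ i ∈ Finset.univ.erase i0, c i * a i ≤ ∑ i, a i0 * a i := by
    refine (Finset.sum_le_sum (g := fun i => a i0 * a i) fun i hi => ?_).trans
      (Finset.sum_le_sum_of_subset_of_nonneg (Finset.erase_subset _ _) fun i _ _ =>
        (mul_pos (ha i0) (ha i)).le)
    exact mul_le_mul_of_nonneg_right (hc i (Finset.ne_of_mem_erase hi)).2.le (ha i).le
  have h2 : 0 ≤ ∑ i ∈ Finset.univ.erase i0, c i * a i :=
    Finset.sum_nonneg fun i hi => mul_nonneg (hc i (Finset.ne_of_mem_erase hi)).1 (ha i).le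
  rw [← Finset.mul_sum] at h1
  constructor <;> nlinarith

lemma many {n : ℕ} {a : Fin n → ℤ} (ha : ∀ i, 0 < a i) {i0 i1 : Fin n} (h01 : i0 ≠ i1) (m : ℕ) {k : ℤ}
    (hk : Finset.univ.gcd a ∣ k) (hb : (∑ i, a i + m * a i1) * a i0 ≤ k) : m ≤ repCount a k := by
  classical
  obtain ⟨c, hc, hc'⟩ := bezout a ha i0 k hk
  have h1 := (coef_bound ha hc' hc).1
  have h2 : (m : ℤ) * a i1 ≤ c i0 := by
    have := le_of_mul_le_mul_right (hb.trans h1) (ha i0)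
    linarith
  refine (le_ncard_iff (sol_finite ha k) m).2 ?_
  let g : ℕ → Fin n → ℤ := fun l i =>
    c i + l * ((if i = i1 then a i0 else 0) - (if i = i0 then a i1 else 0))
  have hg0 : ∀ l : ℕ, l ≤ m → ∀ i, 0 ≤ g l i := by
    intro l hl i
    by_cases hi0 : i = i0
    · subst hi0
      simp only [g, if_neg h01, if_true]
      have : (l : ℤ) * a i1 ≤ m * a i1 := mul_le_mul_of_nonneg_right (by exact_mod_cast hl) (ha i1).le
      linarith
    · have := (hc' i hi0).1
      simp only [g, if_neg hi0, sub_zero]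
      have h3 : 0 ≤ (if i = i1 then a i0 else 0) := by
        split_ifs
        · exact (ha i0).le
        · rfl
      positivity
  refine ⟨fun l i => (g l i).toNat, ?_, ?_⟩
  · intro l l' h
    have h3 := congrFun h i1
    have e : ∀ l : ℕ, g l i1 = c i1 + l * a i0 := by
      intro l
      simp [g, h01.symm]
    have p1 := hg0 l l.2.le i1
    have p2 := hg0 l' l'.2.le i1
    have h4 : g l i1 = g l' i1 := by
      simp only at h3
      omega
    rw [e, e] at h4
    have h5 : ((l : ℕ) : ℤ) = (l' : ℕ) := mul_right_cancel₀ (ha i0).ne' (add_left_cancel h4)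
    exact Fin.ext (by exact_mod_cast h5)
  · intro l
    show k = ∑ i, ((g l i).toNat : ℤ) * a i
    have : ∀ i, ((g l i).toNat : ℤ) = g l i := fun i => Int.toNat_of_nonneg (hg0 l l.2.le i)
    simp only [this]
    simp only [g, add_mul, Finset.sum_add_distrib, ← hc, mul_assoc, ← Finset.mul_sum, sub_mul,
      Finset.sum_sub_distrib, ite_mul, zero_mul, Finset.sum_ite_eq', Finset.mem_univ, if_true]
    ring

/-- auxiliary family -/
noncomputable def pext {n : ℕ} (p : Fin n → Polynomial ℤ) (i0 : Fin n) : Option (Fin n) → Polynomial ℤ :=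
  fun o => o.elim (-p i0) p

lemma gcd_iff {n r s : ℕ} {p : Fin n → Polynomial ℤ} (hs : 0 < s)
    (hp : ∀ i, 0 < (p i).eval (s : ℤ)) (i0 : Fin n)
    (hA : ∑ i, (p i).eval (s : ℤ) < (s : ℤ) ^ r) {x : Fin r → ℕ} (hx : ∀ j, x j < s) :
    (∃ y, (s, x, y) ∈ DRel r (pext p i0)) ↔
      Finset.univ.gcd (fun i => (p i).eval (s : ℤ)) ∣ (val s x : ℤ) := by
  constructor
  · rintro ⟨y, -, hy⟩
    simp only at hy
    rw [← hy]
    refine Finset.dvd_sum fun o _ => Dvd.dvd.mul_right ?_ _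
    cases o with
    | none =>
      simp only [pext, Option.elim_none, Polynomial.eval_neg, dvd_neg]
      exact Finset.gcd_dvd (f := fun i => (p i).eval (s : ℤ)) (Finset.mem_univ i0)
    | some i => exact Finset.gcd_dvd (f := fun i => (p i).eval (s : ℤ)) (Finset.mem_univ i)
  · intro h
    obtain ⟨c, hc, hc'⟩ := bezout _ hp i0 _ h
    obtain ⟨b1, b2⟩ := coef_bound hp hc' hc
    have hv := val_lt x hx
    have hv' : (val s x : ℤ) < (s : ℤ) ^ r := by exact_mod_cast hv
    have hle : ∀ i, (p i).eval (s : ℤ) ≤ ∑ i, (p i).eval (s : ℤ) := fun i =>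
      Finset.single_le_sum (f := fun i => (p i).eval (s : ℤ)) (fun j _ => (hp j).le) (Finset.mem_univ i)
    have hci : ∀ i, c i < (s : ℤ) ^ r := by
      intro i
      by_cases hi : i = i0
      · subst hi
        by_contra hcon
        push Not at hcon
        have := hp i
        nlinarith [pow_pos (show (0 : ℤ) < s by exact_mod_cast hs) r]
      · exact ((hc' i hi).2.trans_le (hle i0)).trans hA
    have hc0 : -c i0 < (s : ℤ) ^ r := by
      refine lt_of_le_of_lt ?_ hA
      by_contra hcon
      push Not at hcon
      have := hp i0
      nlinarith
    let v : Option (Fin n) → ℕ := fun o => o.elim (-c i0).toNat (fun i => (c i).toNat)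
    have hvl : ∀ o, v o < s ^ r := by
      have hz : (0 : ℤ) < (s : ℤ) ^ r := by positivity
      intro o
      have : ((v o : ℕ) : ℤ) < (s : ℤ) ^ r := by
        cases o with
        | none => simp only [v, Option.elim_none]; omega
        | some i => have := hci i; simp only [v, Option.elim_some]; omega
      exact_mod_cast this
    choose y hy1 hy2 using fun o => val_surj (v o) (hvl o)
    refine ⟨fun k => y k.1 k.2, DRel_mk hs hx _ (fun k => hy1 _ _) v hy2 ?_⟩
    rw [Fintype.sum_option, hc]
    simp only [pext, v, Option.elim_none, Option.elim_some, Polynomial.eval_neg]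
    classical
    rw [← Finset.add_sum_erase _ _ (Finset.mem_univ i0), ← Finset.add_sum_erase (a := i0) _ (fun i => c i * _) (Finset.mem_univ i0)]
    have e : ∑ i ∈ Finset.univ.erase i0, (p i).eval (s : ℤ) * ((c i).toNat : ℤ) =
        ∑ i ∈ Finset.univ.erase i0, c i * (p i).eval (s : ℤ) :=
      Finset.sum_congr rfl fun i hi => by
        rw [Int.toNat_of_nonneg (hc' i (Finset.ne_of_mem_erase hi)).1, mul_comm]
    rw [e]
    have : c i0 = ((c i0).toNat : ℤ) - ((-c i0).toNat : ℤ) := by omega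
    linear_combination (-(p i0).eval (s : ℤ)) * this

lemma rep_iff {n m r s : ℕ} {p : Fin n → Polynomial ℤ} (hs : 0 < s)
    (hp : ∀ i, 0 < (p i).eval (s : ℤ)) {x : Fin r → ℕ} (hx : ∀ j, x j < s) :
    (s, x) ∈ RepM m r p ↔ m ≤ repCount (fun i => (p i).eval (s : ℤ)) (val s x : ℤ) := by
  rw [repCount, le_ncard_iff (sol_finite hp _)]
  constructor
  · rintro ⟨y, h1, h2⟩
    refine ⟨fun l i => val s (fun j => y (l, i, j)), ?_, ?_⟩
    · intro l l' h
      by_contra hl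
      refine h2 l l' hl ?_
      funext ⟨i, j⟩
      exact congrFun (val_inj (fun j => (h1 l).1.2.2 (i, j)) (fun j => (h1 l').1.2.2 (i, j))
        (congrFun h i)) j
    · intro l
      have := (h1 l).2
      simp only at this
      show (val s x : ℤ) = _
      rw [← this]
      exact Finset.sum_congr rfl fun i _ => mul_comm _ _
  · rintro ⟨f, hf, h⟩
    have hl : ∀ l i, f l i < s ^ r := by
      intro l i
      have h1 := sol_le hp (h l) i
      have h2 := val_lt x hx
      have : f l i ≤ val s x := by exact_mod_cast h1
      omega
    choose y hy1 hy2 using fun l i => val_surj (f l i) (hl l i)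
    refine ⟨fun k => y k.1 k.2.1 k.2.2, ?_, ?_⟩
    · intro l
      refine DRel_mk hs hx _ (fun k => hy1 _ _ _) (f l) (fun i => hy2 l i) ?_
      have : (val s x : ℤ) = _ := h l
      rw [this]
      exact Finset.sum_congr rfl fun i _ => mul_comm _ _
    · intro l l' hll hc
      refine hll (hf ?_)
      funext i
      rw [← hy2 l i, ← hy2 l' i]
      congr 1
      funext j
      exact congrFun hc (i, j)

lemma core_fix {n m r s : ℕ} {p : Fin n → Polynomial ℤ} (hs : 0 < s)
    (hp : ∀ i, 0 < (p i).eval (s : ℤ)) {i0 i1 : Fin n} (h01 : i0 ≠ i1)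
    (hA : ∑ i, (p i).eval (s : ℤ) < (s : ℤ) ^ r)
    (hB : (∑ i, (p i).eval (s : ℤ) + m * (p i1).eval (s : ℤ)) * (p i0).eval (s : ℤ) < (s : ℤ) ^ r) :
    {k : ℤ | 0 < k ∧ k ∈ frobSet (fun i => (p i).eval (s : ℤ)) m}.ncard =
      {x | (s, x) ∈ FS m r p (pext p i0)}.ncard := by
  have hmem : ∀ x, (s, x) ∈ FS m r p (pext p i0) → ∀ j, x j < s := by
    rintro x ⟨-, ⟨y, hy⟩, -⟩
    exact hy.1.2.1
  have key : ∀ x : Fin r → ℕ, (∀ j, x j < s) → ((s, x) ∈ FS m r p (pext p i0) ↔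
      (0 : ℤ) < (val s x : ℤ) ∧ (val s x : ℤ) ∈ frobSet (fun i => (p i).eval (s : ℤ)) m) := by
    intro x hx
    simp only [FS, Set.mem_ofPred_eq, frobSet]
    rw [gcd_iff hs hp i0 hA hx, rep_iff hs hp hx, not_le]
    refine and_congr ?_ Iff.rfl
    have h0 : val s (0 : Fin r → ℕ) = 0 := by simp [val]
    rw [← not_iff_not]
    push Not
    constructor
    · rintro rfl
      simp [h0]
    · intro h
      refine val_inj hx (fun j => hs) ?_
      rw [h0]
      omega
  symm
  rw [← Set.InjOn.ncard_image (f := fun x => (val s x : ℤ))]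
  · congr 1
    ext k
    constructor
    · rintro ⟨x, hx, rfl⟩
      exact (key x (hmem x hx)).1 hx
    · rintro ⟨h0, hk⟩
      have hlt : k < (s : ℤ) ^ r := by
        by_contra hcon
        push Not at hcon
        have := many hp h01 m hk.1 (hB.le.trans hcon)
        exact absurd hk.2 (by omega)
      lift k to ℕ using h0.le
      obtain ⟨x, hx, rfl⟩ := val_surj (r := r) (s := s) k (by exact_mod_cast hlt)
      exact ⟨x, (key x hx).2 ⟨h0, hk⟩, rfl⟩
  · intro x hx y hy h
    exact val_inj (hmem x hx) (hmem y hy) (Int.ofNat_inj.1 h)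

lemma poly_lt (Q : Polynomial ℤ) : ∃ r0, ∀ r ≥ r0, ∃ N : ℕ, ∀ s : ℕ, N ≤ s → Q.eval (s : ℤ) < (s : ℤ) ^ r := by
  refine ⟨Q.natDegree + 1, fun r hr => ⟨(∑ i ∈ Finset.range (Q.natDegree + 1), |Q.coeff i|).toNat + 1, fun s hs => ?_⟩⟩
  rw [Polynomial.eval_eq_sum_range]
  have hs1 : (1 : ℤ) ≤ s := by omega
  calc _ ≤ ∑ i ∈ Finset.range (Q.natDegree + 1), |Q.coeff i| * (s : ℤ) ^ Q.natDegree := by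
        refine Finset.sum_le_sum fun i hi => ?_
        have h1 : (s : ℤ) ^ i ≤ (s : ℤ) ^ Q.natDegree :=
          pow_le_pow_right₀ hs1 (by have := Finset.mem_range.1 hi; omega)
        calc Q.coeff i * (s : ℤ) ^ i ≤ |Q.coeff i| * (s : ℤ) ^ i :=
              mul_le_mul_of_nonneg_right (le_abs_self _) (by positivity)
          _ ≤ _ := mul_le_mul_of_nonneg_left h1 (abs_nonneg _)
    _ = (∑ i ∈ Finset.range (Q.natDegree + 1), |Q.coeff i|) * (s : ℤ) ^ Q.natDegree := by
        rw [Finset.sum_mul]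
    _ < s * (s : ℤ) ^ Q.natDegree := by
        refine mul_lt_mul_of_pos_right ?_ (by positivity)
        omega
    _ = (s : ℤ) ^ (Q.natDegree + 1) := by ring
    _ ≤ _ := pow_le_pow_right₀ hs1 hr

lemma EQ_congr {f g : ℕ → ℚ} (hf : EQ f) (N : ℕ) (h : ∀ t, N ≤ t → g t = f t) : EQ g := by
  obtain ⟨d, hd, R, N', hR⟩ := hf
  refine ⟨d, hd, R, max N N', fun t ht => ?_⟩
  rw [h t (le_of_max_le_left ht), hR t (le_of_max_le_right ht)]

lemma core (n m : ℕ) (hn : 2 ≤ n) (p : Fin n → Polynomial ℤ) (N0 : ℕ)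
    (hp : ∀ s : ℕ, N0 ≤ s → ∀ i, 0 < (p i).eval (s : ℤ)) :
    EQ (fun s => ({k : ℤ | 0 < k ∧ k ∈ frobSet (fun i => (p i).eval (s : ℤ)) m}.ncard : ℚ)) := by
  let i0 : Fin n := ⟨0, by omega⟩
  let i1 : Fin n := ⟨1, by omega⟩
  have h01 : i0 ≠ i1 := by simp [i0, i1, Fin.ext_iff]
  obtain ⟨r1, h1⟩ := poly_lt (∑ i, p i)
  obtain ⟨r2, h2⟩ := poly_lt ((∑ i, p i + (m : Polynomial ℤ) * p i1) * p i0)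
  obtain ⟨N1, h1⟩ := h1 (max r1 r2) (le_max_left _ _)
  obtain ⟨N2, h2⟩ := h2 (max r1 r2) (le_max_right _ _)
  refine EQ_congr (EQ_FS m (max r1 r2) p (pext p i0)) (N0 + N1 + N2 + 1) fun s hs => ?_
  congr 1
  refine core_fix (by omega) (hp s (by omega)) h01 ?_ ?_
  · simpa [Polynomial.eval_finsetSum] using h1 s (by omega)
  · simpa [Polynomial.eval_finsetSum] using h2 s (by omega)


lemma clear_den (P : Polynomial ℚ) : ∃ D : ℕ, 0 < D ∧ ∃ p : Polynomial ℤ,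
    p.map (Int.castRingHom ℚ) = Polynomial.C (D : ℚ) * P := by
  obtain ⟨b, hb⟩ := IsLocalization.integerNormalization_map_to_map (nonZeroDivisors ℤ) P
  have hb0 : (b : ℤ) ≠ 0 := nonZeroDivisors.coe_ne_zero b
  refine ⟨((b : ℤ) * b).natAbs, Int.natAbs_pos.2 (mul_ne_zero hb0 hb0),
    Polynomial.C (b : ℤ) * IsLocalization.integerNormalization (nonZeroDivisors ℤ) P, ?_⟩
  have e : ((((b : ℤ) * b).natAbs : ℕ) : ℚ) = (b : ℤ) * (b : ℤ) := by
    rw [Nat.cast_natAbs, abs_of_nonneg (mul_self_nonneg _)]; push_cast; rfl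
  rw [e, Polynomial.map_mul, Polynomial.map_C]
  have hb' : (IsLocalization.integerNormalization (nonZeroDivisors ℤ) P).map (Int.castRingHom ℚ) =
      Polynomial.C ((b : ℤ) : ℚ) * P := by
    rw [← Polynomial.smul_eq_C_mul]
    refine hb.trans ?_
    ext i
    simp
  rw [hb', Polynomial.C_mul, mul_assoc]
  rfl

lemma shift_poly {P : Polynomial ℚ} (hint : ∀ z : ℤ, ∃ w : ℤ, P.eval (z : ℚ) = (w : ℚ)) {D : ℕ}
    (hD : 0 < D) {p : Polynomial ℤ} (hp : p.map (Int.castRingHom ℚ) = Polynomial.C (D : ℚ) * P) (ρ : ℕ) :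
    ∃ q : Polynomial ℤ, ∀ s : ℕ, ((q.eval (s : ℤ) : ℤ) : ℚ) = P.eval (((ρ + D * s : ℕ)) : ℚ) := by
  obtain ⟨w, hw⟩ := hint ρ
  obtain ⟨q, hq⟩ := Polynomial.sub_dvd_eval_sub
    (Polynomial.C (ρ : ℤ) + Polynomial.C (D : ℤ) * Polynomial.X) (Polynomial.C (ρ : ℤ)) (p.map Polynomial.C)
  refine ⟨Polynomial.C w + Polynomial.X * q, fun s => ?_⟩
  have h1 := congrArg (Polynomial.eval (s : ℤ)) hq
  have hev : ∀ z : ℤ, ((p.eval z : ℤ) : ℚ) = D * P.eval (z : ℚ) := by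
    intro z
    have := congrArg (Polynomial.eval (z : ℚ)) hp
    rw [Polynomial.eval_intCast_map] at this
    simpa using this
  have hcm : ∀ u : Polynomial ℤ, ((p.map Polynomial.C).eval u).eval (s : ℤ) = p.eval (u.eval (s : ℤ)) := by
    intro u
    rw [Polynomial.eval_map]
    exact Polynomial.eval_comp
  rw [Polynomial.eval_sub, hcm, hcm] at h1
  simp only [Polynomial.eval_add, Polynomial.eval_C,
    Polynomial.eval_mul, Polynomial.eval_X, add_sub_cancel_left] at h1
  have h2 := congrArg (fun z : ℤ => (z : ℚ)) h1
  simp only [Int.cast_sub, hev] at h2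
  have hD' : (D : ℚ) ≠ 0 := by exact_mod_cast hD.ne'
  push_cast at h2 hw ⊢
  simp only [Polynomial.eval_add, Polynomial.eval_C, Polynomial.eval_mul, Polynomial.eval_X]
  push_cast
  rw [← hw]
  refine mul_left_cancel₀ hD' ?_
  linear_combination -h2

lemma pos_ev {P : Polynomial ℚ} (h : 0 < P.leadingCoeff) : ∃ N : ℕ, ∀ t : ℕ, N ≤ t → 0 < P.eval (t : ℚ) := by
  by_cases hd : 0 < P.degree
  · have := (P.tendsto_atTop_of_leadingCoeff_nonneg hd h.le).comp (tendsto_natCast_atTop_atTop (R := ℚ))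
    exact Filter.eventually_atTop.1 (this.eventually_gt_atTop 0)
  · have := Polynomial.eq_C_of_degree_le_zero (not_lt.1 hd)
    refine ⟨0, fun t _ => ?_⟩
    rw [this] at h ⊢
    simpa using h

lemma EQ_glue (f : ℕ → ℚ) (D : ℕ) (hD : 0 < D) (g : ℕ → ℕ → ℚ) (hg : ∀ ρ, EQ (g ρ)) (N : ℕ)
    (h : ∀ t, N ≤ t → f t = g (t % D) (t / D)) : EQ f := by
  choose d hd R M hR using hg
  have hK : 0 < ∏ ρ ∈ Finset.range D, d ρ := Finset.prod_pos fun ρ _ => hd ρ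
  refine ⟨D * ∏ ρ ∈ Finset.range D, d ρ, Nat.mul_pos hD hK,
    fun i => (R (i % D) (i / D % d (i % D))).comp
      (Polynomial.C ((D : ℚ)⁻¹) * (Polynomial.X - Polynomial.C ((i % D : ℕ) : ℚ))),
    N + D * ∑ ρ ∈ Finset.range D, M ρ, fun t ht => ?_⟩
  have hlt : t % D < D := Nat.mod_lt _ hD
  have hMle : M (t % D) ≤ ∑ ρ ∈ Finset.range D, M ρ :=
    Finset.single_le_sum (f := M) (fun _ _ => Nat.zero_le _) (Finset.mem_range.2 hlt)
  have hq : M (t % D) ≤ t / D := by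
    refine hMle.trans ((Nat.le_div_iff_mul_le hD).2 ?_)
    rw [mul_comm]; omega
  beta_reduce
  rw [h t (by omega), hR _ _ hq, Nat.mod_mul_right_mod, Nat.mod_mul_right_div_self,
    Nat.mod_mod_of_dvd _ (Finset.dvd_prod_of_mem d (Finset.mem_range.2 hlt)), Polynomial.eval_comp]
  congr 1
  simp only [Polynomial.eval_mul, Polynomial.eval_C, Polynomial.eval_sub, Polynomial.eval_X]
  have hD' : (D : ℚ) ≠ 0 := by exact_mod_cast hD.ne'
  have e : (t : ℚ) = (t % D : ℕ) + D * (t / D : ℕ) := by exact_mod_cast (Nat.mod_add_div t D).symm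
  rw [eq_inv_mul_iff_mul_eq₀ hD']
  linear_combination -e

theorem G_m_eqp (n m : ℕ) (hn : 2 ≤ n) (hm : 0 < m)
    (P : Fin n → Polynomial ℚ)
    (hint : ∀ i, ∀ z : ℤ, ∃ w : ℤ, (P i).eval (z : ℚ) = (w : ℚ))
    (hlead : ∀ i, 0 < (P i).leadingCoeff)
    (a : Fin n → ℕ → ℤ)
    (ha : ∃ N : ℕ, ∀ t : ℕ, N ≤ t → ∀ i, (a i t : ℚ) = (P i).eval (t : ℚ))
    (E : ℕ → ℤ)
    (hE : ∃ N : ℕ, ∀ t : ℕ, N ≤ t →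
      E t = ({k : ℤ | 0 < k ∧ k ∈ frobSet (fun i => a i t) m}.ncard : ℤ)) :
    IsEQP E := by
  classical
  obtain ⟨N1, ha⟩ := ha
  obtain ⟨N2, hE⟩ := hE
  choose N3 hN3 using fun i => pos_ev (hlead i)
  choose D0 hD0 p0 hp0 using fun i => clear_den (P i)
  have hD : 0 < ∏ i, D0 i := Finset.prod_pos fun i _ => hD0 i
  have hq : ∀ ρ : ℕ, ∀ i, ∃ q : Polynomial ℤ, ∀ s : ℕ,
      ((q.eval (s : ℤ) : ℤ) : ℚ) = (P i).eval (((ρ + (∏ i, D0 i) * s : ℕ)) : ℚ) := by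
    intro ρ i
    refine shift_poly (hint i) hD
      (p := Polynomial.C ((∏ j ∈ Finset.univ.erase i, D0 j : ℕ) : ℤ) * p0 i) ?_ ρ
    rw [Polynomial.map_mul, hp0, ← Finset.mul_prod_erase _ _ (Finset.mem_univ i), Polynomial.map_C,
      ← mul_assoc, ← Polynomial.C_mul]
    congr 2
    push_cast
    simp [mul_comm]
  choose q hq using hq
  have hc : ∀ ρ, EQ (fun s => ({k : ℤ | 0 < k ∧ k ∈ frobSet (fun i => (q ρ i).eval (s : ℤ)) m}.ncard : ℚ)) := by
    intro ρ
    refine core n m hn (q ρ) (∑ i, N3 i) fun s hs i => ?_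
    have h1 : N3 i ≤ ∑ i, N3 i := Finset.single_le_sum (fun _ _ => Nat.zero_le _) (Finset.mem_univ i)
    have h2 : s ≤ (∏ i, D0 i) * s := Nat.le_mul_of_pos_left s hD
    have := hN3 i (ρ + (∏ i, D0 i) * s) (by omega)
    rw [← hq] at this
    exact_mod_cast this
  refine EQ_glue (fun t => (E t : ℚ)) _ hD _ hc (N1 + N2) fun t ht => ?_
  have e : ∀ i, a i t = (q (t % ∏ i, D0 i) i).eval ((t / ∏ i, D0 i : ℕ) : ℤ) := by
    intro i
    have h1 := hq (t % ∏ i, D0 i) i (t / ∏ i, D0 i)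
    rw [Nat.mod_add_div, ← ha t (by omega) i] at h1
    exact_mod_cast h1.symm
  beta_reduce
  rw [hE t (by omega)]
  simp only [e]
  push_cast
  rfl
end
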